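/- Fix β ∈ (0,1), ε > 0 sufficiently small, and K > 0, all independent of N. For a real symmetric N×N matrix W and h ≥ 0, let m_W(h) = (1/N)·E_{σ ~ μ_{βW,h𝟏}}[⟨σ,𝟏⟩]. Then there exists a constant C such that for every δ > 0 there is N₀ with the following for all N ≥ N₀: with probability at least 1 − δ over W ~ GOE(N), simultaneously for all h ∈ [0, K]: (i) if h < N^{−(1/4+ε)}, then |m_W(h) − q₁(β,h)| ≤ C·( q₁(β,h)·N^{−ε} + N^{−(1/2+ε)} ); and (ii) if h ≥ N^{−(1/4+ε)}, then |m_W(h) − q₁(β,h)| ≤ C·N^{−(1/2−ε)}. -/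

import Mathlib

open MeasureTheory ProbabilityTheory

noncomputable section

/-- Standard Gaussian measure on `ℝ`. -/
def stdGaussian : Measure ℝ := gaussianReal 0 1

/-- The overlap constant `q_{β,h}`, the unique solution in `(0,1]` of the replica-symmetric
fixed point equation (set to `0` for `h = 0`). -/
def qOverlap (β h : ℝ) : ℝ :=
  if h = 0 then 0 else
    sSup {q : ℝ | q ∈ Set.Ioc (0 : ℝ) 1 ∧
      q = ∫ g, Real.tanh (β * g * Real.sqrt q + h) ^ 2 ∂stdGaussian}

/-- `q₁(β,h) = E tanh(β g √q_{β,h} + h)`. -/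
def q1 (β h : ℝ) : ℝ :=
  ∫ g, Real.tanh (β * g * Real.sqrt (qOverlap β h) + h) ∂stdGaussian

/-- Hyperbolic secant. -/
def sech (x : ℝ) : ℝ := 1 / Real.cosh x

/-- The Almeida–Thouless condition for `(β,h)`. -/
def ATCond (β h : ℝ) : Prop :=
  β ^ 2 * ∫ g, sech (β * g * Real.sqrt (qOverlap β h) + h) ^ 4 ∂stdGaussian < 1

/-- The AT condition with gap at least `g0`. -/
def ATgap (β h g0 : ℝ) : Prop :=
  β ^ 2 * ∫ g, sech (β * g * Real.sqrt (qOverlap β h) + h) ^ 4 ∂stdGaussian ≤ 1 - g0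

/-- The one-dimensional RGD/AMP update map `f_{β,λ}`. -/
def fbl (β lam z : ℝ) : ℝ :=
  ∫ g, Real.tanh (β * g * Real.sqrt (qOverlap β (β * lam * z)) + β * lam * z) ∂stdGaussian

/-- `h_* = inf{h ≥ 0 : (β,h) satisfies AT}`. -/
def hStar (β : ℝ) : ℝ := sInf {h : ℝ | 0 ≤ h ∧ ATCond β h}

/-- The spin value of a Boolean. -/
def spin (b : Bool) : ℝ := if b then 1 else -1

/-- Normalized correlation `R(σ,ρ) = ⟨σ,ρ⟩/N`. -/
def overlap {N : ℕ} (σ ρ : Fin N → Bool) : ℝ := (∑ i, spin (σ i) * spin (ρ i)) / N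

/-- The all-ones configuration `𝟏`. -/
def onesConf (N : ℕ) : Fin N → Bool := fun _ => true

/-- Unnormalized SK Gibbs weight with interaction `β W` and external field `h 𝟏`. -/
def skWeight {N : ℕ} (W : Matrix (Fin N) (Fin N) ℝ) (β h : ℝ) (σ : Fin N → Bool) : ℝ :=
  Real.exp (β / 2 * (∑ i, ∑ j, W i j * spin (σ i) * spin (σ j)) + h * ∑ i, spin (σ i))

/-- SK partition function. -/
def skZ {N : ℕ} (W : Matrix (Fin N) (Fin N) ℝ) (β h : ℝ) : ℝ :=
  ∑ σ : Fin N → Bool, skWeight W β h σ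

/-- Normalized SK Gibbs density. -/
def skDensity {N : ℕ} (W : Matrix (Fin N) (Fin N) ℝ) (β h : ℝ) (σ : Fin N → Bool) : ℝ :=
  skWeight W β h σ / skZ W β h

/-- The SK Gibbs measure `μ_{βW, h𝟏}` on `{±1}^N`. -/
def skGibbs {N : ℕ} (W : Matrix (Fin N) (Fin N) ℝ) (β h : ℝ) : Measure (Fin N → Bool) :=
  ∑ σ : Fin N → Bool, ENNReal.ofReal (skDensity W β h σ) • Measure.dirac σ

instance matrixMeasurableSpace {N : ℕ} : MeasurableSpace (Matrix (Fin N) (Fin N) ℝ) :=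
  (inferInstance : MeasurableSpace (Fin N → Fin N → ℝ))

/-- The GOE(N) random matrix ensemble. -/
def GOE (N : ℕ) : Measure (Matrix (Fin N) (Fin N) ℝ) :=
  (Measure.pi fun p : Fin N × Fin N =>
      if p.1 = p.2 then gaussianReal 0 (2 / N) else gaussianReal 0 (1 / N)).map
    (fun W => Matrix.of fun i j => if i ≤ j then W (i, j) else W (j, i))

/-- The mean magnetization `m_W(h) = (1/N) E_{σ ~ μ_{βW,h𝟏}} ⟨σ,𝟏⟩`. -/
def meanMag {N : ℕ} (W : Matrix (Fin N) (Fin N) ℝ) (β h : ℝ) : ℝ :=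
  (1 / (N : ℝ)) * ∫ σ, (∑ i, spin (σ i)) ∂skGibbs W β h

set_option linter.unusedSectionVars false
set_option linter.unusedVariables false

/-! ### Log-sum-exp and Gibbs averages -/

/-- log-sum-exp -/
def lse {A : Type*} [Fintype A] (u : A → ℝ) : ℝ := Real.log (∑ a, Real.exp (u a))

/-- Gibbs average with log-weights `u` -/
def gav {A : Type*} [Fintype A] (u g : A → ℝ) : ℝ :=
  (∑ a, g a * Real.exp (u a)) / ∑ a, Real.exp (u a)

section gavlemmas
variable {A : Type*} [Fintype A] [Nonempty A]

lemma sumexp_pos (u : A → ℝ) : 0 < ∑ a, Real.exp (u a) :=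
  Finset.sum_pos (fun a _ => Real.exp_pos _) Finset.univ_nonempty

lemma exp_lse (u : A → ℝ) : Real.exp (lse u) = ∑ a, Real.exp (u a) :=
  Real.exp_log (sumexp_pos u)

lemma gav_add (u g k : A → ℝ) : gav u (fun a => g a + k a) = gav u g + gav u k := by
  simp only [gav, add_mul, Finset.sum_add_distrib, add_div]

lemma gav_sub (u g k : A → ℝ) : gav u (fun a => g a - k a) = gav u g - gav u k := by
  simp only [gav, sub_mul, Finset.sum_sub_distrib, sub_div]

lemma gav_const_mul (u g : A → ℝ) (c : ℝ) : gav u (fun a => c * g a) = c * gav u g := by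
  simp only [gav, mul_assoc, ← Finset.mul_sum, mul_div_assoc]

lemma gav_mul_const (u g : A → ℝ) (c : ℝ) : gav u (fun a => g a * c) = gav u g * c := by
  simp only [mul_comm _ c, gav_const_mul]

lemma gav_const (u : A → ℝ) (c : ℝ) : gav u (fun _ => c) = c := by
  simp only [gav, ← Finset.mul_sum]
  exact mul_div_cancel_right₀ _ (sumexp_pos u).ne'

lemma gav_mono (u : A → ℝ) {g k : A → ℝ} (h : ∀ a, g a ≤ k a) : gav u g ≤ gav u k := by
  unfold gav
  have := sumexp_pos u
  gcongr with a
  exact h a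

lemma gav_nonneg (u : A → ℝ) {g : A → ℝ} (h : ∀ a, 0 ≤ g a) : 0 ≤ gav u g := by
  have := gav_mono u (g := fun _ => 0) h
  rwa [gav_const] at this

lemma gav_abs_le (u : A → ℝ) {g : A → ℝ} {C : ℝ} (h : ∀ a, |g a| ≤ C) : |gav u g| ≤ C := by
  rw [abs_le]
  constructor
  · have := gav_mono u (g := fun _ => -C) (k := g) (fun a => (abs_le.1 (h a)).1)
    rwa [gav_const] at this
  · have := gav_mono u (g := g) (k := fun _ => C) (fun a => (abs_le.1 (h a)).2)
    rwa [gav_const] at this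

lemma gav_sum {κ : Type*} (s : Finset κ) (u : A → ℝ) (g : κ → A → ℝ) :
    gav u (fun a => ∑ k ∈ s, g k a) = ∑ k ∈ s, gav u (g k) := by
  simp only [gav, Finset.sum_mul, Finset.sum_div]
  rw [Finset.sum_comm]
  

lemma gav_exp (u f : A → ℝ) :
    gav u (fun a => Real.exp (f a)) = Real.exp (lse (fun a => u a + f a) - lse u) := by
  rw [Real.exp_sub, exp_lse, exp_lse, gav]
  congr 1
  refine Finset.sum_congr rfl fun a _ => ?_
  rw [← Real.exp_add, add_comm]

/-- Jensen -/
lemma gav_le_lse (u f : A → ℝ) : gav u f ≤ lse (fun a => u a + f a) - lse u := by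
  rw [← Real.exp_le_exp, ← gav_exp]
  set c := gav u f
  have h1 : ∀ a, Real.exp c * (1 + (f a - c)) ≤ Real.exp (f a) := by
    intro a
    have := Real.add_one_le_exp (f a - c)
    calc Real.exp c * (1 + (f a - c)) ≤ Real.exp c * Real.exp (f a - c) := by
          gcongr; linarith
      _ = Real.exp (f a) := by rw [← Real.exp_add]; congr 1; ring
  have h2 := gav_mono u h1
  rw [gav_const_mul, gav_add, gav_const, gav_sub, gav_const] at h2
  have : gav u f - c = 0 := sub_self _
  rw [this] at h2
  simpa using h2

lemma hasDerivAt_sumexp {u : ℝ → A → ℝ} {u' : A → ℝ} {t : ℝ}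
    (h : ∀ a, HasDerivAt (fun t => u t a) (u' a) t) (g : A → ℝ) :
    HasDerivAt (fun t => ∑ a, g a * Real.exp (u t a)) (∑ a, g a * u' a * Real.exp (u t a)) t := by
  have : ∀ a ∈ Finset.univ, HasDerivAt (fun t => g a * Real.exp (u t a))
      (g a * u' a * Real.exp (u t a)) t := by
    intro a _
    exact (((h a).exp).const_mul (g a)).congr_deriv (by ring)
  exact HasDerivAt.fun_sum this

lemma hasDerivAt_lse {u : ℝ → A → ℝ} {u' : A → ℝ} {t : ℝ}
    (h : ∀ a, HasDerivAt (fun t => u t a) (u' a) t) :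
    HasDerivAt (fun t => lse (u t)) (gav (u t) u') t := by
  have := hasDerivAt_sumexp h (fun _ => 1)
  simp only [one_mul] at this
  exact this.log (sumexp_pos _).ne'

lemma hasDerivAt_gav {u : ℝ → A → ℝ} {u' : A → ℝ} {t : ℝ}
    (h : ∀ a, HasDerivAt (fun t => u t a) (u' a) t) (g : A → ℝ) :
    HasDerivAt (fun t => gav (u t) g)
      (gav (u t) (fun a => g a * u' a) - gav (u t) g * gav (u t) u') t := by
  have h1 := hasDerivAt_sumexp h (fun _ => 1)
  simp only [one_mul] at h1
  have h2 := (hasDerivAt_sumexp h g).fun_div h1 (sumexp_pos _).ne'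
  refine h2.congr_deriv ?_
  have := (sumexp_pos (u t)).ne'
  unfold gav
  field_simp

lemma continuous_lse {X : Type*} [TopologicalSpace X] {u : X → A → ℝ}
    (h : ∀ a, Continuous fun x => u x a) : Continuous fun x => lse (u x) := by
  unfold lse
  refine Continuous.log ?_ (fun x => (sumexp_pos _).ne')
  fun_prop

lemma continuous_gav {X : Type*} [TopologicalSpace X] {u : X → A → ℝ} (g : A → ℝ)
    (h : ∀ a, Continuous fun x => u x a) : Continuous fun x => gav (u x) g := by
  unfold gav
  refine Continuous.div ?_ ?_ (fun x => (sumexp_pos _).ne') <;> fun_prop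

lemma lse_sub_abs_le {u f : A → ℝ} {C : ℝ} (h : ∀ a, |f a| ≤ C) :
    |lse (fun a => u a + f a) - lse u| ≤ C := by
  have h1 := gav_le_lse u f
  have h2 := gav_le_lse (fun a => u a + f a) (fun a => - f a)
  simp only [add_neg_cancel_right] at h2
  have h3 := (abs_le.1 (gav_abs_le u h)).1
  have h4 := (abs_le.1 (gav_abs_le (fun a => u a + f a) (g := fun a => - f a)
    (C := C) (by simpa using h))).1
  rw [abs_le]
  constructor <;> linarith

end gavlemmas

section pairs
variable {B : Type*} [Fintype B] [Nonempty B]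

/-- log-weight of a pair -/
def pairW (u : B → ℝ) : B × B → ℝ := fun a => u a.1 + u a.2

lemma sumexp_pair (u : B → ℝ) : ∑ a : B × B, Real.exp (pairW u a) =
    (∑ b, Real.exp (u b)) * ∑ b, Real.exp (u b) := by
  rw [Fintype.sum_prod_type, Finset.sum_mul_sum]
  simp only [pairW, Real.exp_add]

lemma gav_pair (u : B → ℝ) (g : B → B → ℝ) :
    gav (pairW u) (fun a => g a.1 a.2) = gav u (fun x => gav u (fun y => g x y)) := by
  have := (sumexp_pos u).ne'
  unfold gav
  rw [sumexp_pair, Fintype.sum_prod_type]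
  simp only [pairW, Real.exp_add]
  rw [div_eq_div_iff (by positivity) this, Finset.sum_mul, Finset.sum_mul]
  refine Finset.sum_congr rfl fun x _ => ?_
  field_simp
  rw [Finset.mul_sum]
  refine Finset.sum_congr rfl fun y _ => ?_
  ring

lemma gav_pair_fst (u : B → ℝ) (g : B → ℝ) : gav (pairW u) (fun a => g a.1) = gav u g := by
  rw [gav_pair u (fun x _ => g x)]
  simp only [gav_const]

lemma gav_pair_snd (u : B → ℝ) (g : B → ℝ) : gav (pairW u) (fun a => g a.2) = gav u g := by
  rw [gav_pair u (fun _ y => g y)]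
  simp only [gav_const]

end pairs

/-! ### Gaussian integration by parts -/

/-- standard Gaussian on the line -/
abbrev gam : Measure ℝ := gaussianReal 0 1

lemma gam_integral (f : ℝ → ℝ) :
    ∫ y, f y ∂gam = ∫ y, (Real.sqrt (2 * Real.pi))⁻¹ * Real.exp (-(1/2) * y ^ 2) * f y := by
  rw [integral_gaussianReal_eq_integral_smul (by norm_num)]
  refine integral_congr_ae (Filter.Eventually.of_forall fun y => ?_)
  simp only [gaussianPDFReal, smul_eq_mul, NNReal.coe_one, mul_one, sub_zero]
  congr 3
  ring

lemma stein_one {G G' : ℝ → ℝ} {C : ℝ} (hd : ∀ y, HasDerivAt G (G' y) y)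
    (hG : ∀ y, |G y| ≤ C) (hG' : ∀ y, |G' y| ≤ C) :
    ∫ y, y * G y ∂gam = ∫ y, G' y ∂gam := by
  rw [gam_integral, gam_integral]
  set c := (Real.sqrt (2 * Real.pi))⁻¹
  have hGc : Continuous G := continuous_iff_continuousAt.2 fun y => (hd y).continuousAt
  have hG'm : Measurable G' := by
    have : G' = deriv G := by ext y; exact (hd y).deriv.symm
    rw [this]; exact measurable_deriv G
  have i1 : Integrable (fun y : ℝ => c * Real.exp (-(1/2) * y ^ 2)) :=
    (integrable_exp_neg_mul_sq (by norm_num)).const_mul c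
  have i2 : Integrable (fun y : ℝ => c * (y * Real.exp (-(1/2) * y ^ 2))) :=
    (integrable_mul_exp_neg_mul_sq (by norm_num)).const_mul c
  have j0 : Integrable (fun y : ℝ => c * Real.exp (-(1/2) * y ^ 2) * G y) :=
    i1.mul_bdd (c := C) hGc.aestronglyMeasurable (Filter.Eventually.of_forall hG)
  have j1 : Integrable (fun y : ℝ => c * Real.exp (-(1/2) * y ^ 2) * G' y) :=
    i1.mul_bdd (c := C) hG'm.aestronglyMeasurable (Filter.Eventually.of_forall hG')
  have j2 : Integrable (fun y : ℝ => c * Real.exp (-(1/2) * y ^ 2) * (y * G y)) := by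
    have := i2.mul_bdd (c := C) hGc.aestronglyMeasurable (Filter.Eventually.of_forall hG)
    refine this.congr (Filter.Eventually.of_forall fun y => ?_)
    simp only; ring
  have key := integral_eq_zero_of_hasDerivAt_of_integrable
    (f := fun y : ℝ => c * Real.exp (-(1/2) * y ^ 2) * G y)
    (f' := fun y : ℝ => c * Real.exp (-(1/2) * y ^ 2) * G' y
      - c * Real.exp (-(1/2) * y ^ 2) * (y * G y)) (fun y => ?_) (j1.sub j2) j0
  · rw [integral_sub j1 j2] at key
    linarith
  · have h1 : HasDerivAt (fun y : ℝ => -(1/2) * y ^ 2) (-y) y :=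
      ((hasDerivAt_pow 2 y).const_mul (-(1/2 : ℝ))).congr_deriv (by norm_num; ring)
    exact (((h1.exp).const_mul c).fun_mul (hd y)).congr_deriv (by ring)

section multi
variable {ι : Type*} [Fintype ι] [DecidableEq ι]

/-- standard Gaussian on `ι → ℝ` -/
abbrev gamPi (ι : Type*) [Fintype ι] : Measure (ι → ℝ) := Measure.pi fun _ => gam

lemma resample (k : ι) :
    MeasurePreserving (fun z : (ι → ℝ) × ℝ => Function.update z.1 k z.2)
      ((gamPi ι).prod gam) (gamPi ι) := by
  have hm : Measurable (fun z : (ι → ℝ) × ℝ => Function.update z.1 k z.2) := by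
    refine measurable_pi_iff.2 fun i => ?_
    by_cases h : i = k
    · subst h; simpa using measurable_snd
    · simp only [Function.update_of_ne h]
      exact (measurable_pi_apply i).comp measurable_fst
  refine ⟨hm, ?_⟩
  symm
  refine Measure.pi_eq fun s hs => ?_
  rw [Measure.map_apply hm (MeasurableSet.univ_pi hs)]
  have : (fun z : (ι → ℝ) × ℝ => Function.update z.1 k z.2) ⁻¹' (Set.univ.pi s) =
      (Set.univ.pi (Function.update s k Set.univ)) ×ˢ (s k) := by
    ext z
    simp only [Set.mem_preimage, Set.mem_pi, Set.mem_univ, true_implies, Set.mem_prod]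
    constructor
    · intro h
      refine ⟨fun i => ?_, by simpa using h k⟩
      by_cases hi : i = k
      · subst hi; simp
      · simpa [hi] using h i
    · rintro ⟨h1, h2⟩ i
      by_cases hi : i = k
      · subst hi; simpa using h2
      · simpa [hi] using h1 i
  rw [this, Measure.prod_prod, Measure.pi_pi, ← Finset.prod_erase_mul _ _ (Finset.mem_univ k),
    ← Finset.prod_erase_mul (a := k) _ _ (Finset.mem_univ k)]
  simp only [Function.update_self, measure_univ, mul_one]
  congr 1
  refine Finset.prod_congr rfl fun i hi => ?_
  rw [Function.update_of_ne (Finset.ne_of_mem_erase hi)]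

lemma integrable_coord (k : ι) : Integrable (fun x : ι → ℝ => x k) (gamPi ι) := by
  have : Integrable (fun y : ℝ => y) gam := by
    have := (memLp_id_gaussianReal (μ := 0) (v := 1) 1).integrable (by norm_num)
    exact this
  exact integrable_comp_eval (μ := fun _ : ι => gam) (i := k) this

lemma stein_pi (k : ι) {G G' : (ι → ℝ) → ℝ} {C : ℝ}
    (hd : ∀ x y, HasDerivAt (fun y => G (Function.update x k y)) (G' (Function.update x k y)) y)
    (hGc : Continuous G) (hGc' : Continuous G')
    (hG : ∀ y, |G y| ≤ C) (hG' : ∀ y, |G' y| ≤ C) :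
    Integrable G' (gamPi ι) ∧ Integrable (fun x => x k * G x) (gamPi ι) ∧
    ∫ x, x k * G x ∂gamPi ι = ∫ x, G' x ∂gamPi ι := by
  have i1 : Integrable G' (gamPi ι) :=
    Integrable.of_bound hGc'.aestronglyMeasurable C (Filter.Eventually.of_forall hG')
  have i2 : Integrable (fun x => x k * G x) (gamPi ι) :=
    (integrable_coord k).mul_bdd (c := C) hGc.aestronglyMeasurable (Filter.Eventually.of_forall hG)
  refine ⟨i1, i2, ?_⟩
  have mp := resample (ι := ι) k
  rw [← mp.map_eq, integral_map mp.measurable.aemeasurable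
    (by rw [mp.map_eq]; exact i2.aestronglyMeasurable),
    integral_map mp.measurable.aemeasurable
    (by rw [mp.map_eq]; exact i1.aestronglyMeasurable)]
  have e1 := mp.integrable_comp_of_integrable i1
  have e2 := mp.integrable_comp_of_integrable i2
  simp only [Function.comp_def] at e1 e2
  rw [integral_prod _ e1, integral_prod _ e2]
  refine integral_congr_ae (Filter.Eventually.of_forall fun x => ?_)
  simp only [Function.update_self]
  exact stein_one (hd x) (fun y => hG _) (fun y => hG' _)

end multi

/-! ### The abstract interpolation inequality -/

section interp
variable {A : Type*} [Fintype A] [Nonempty A] {ι : Type*} [Fintype ι]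

/-- Gaussian Hamiltonian -/
def iV (ψ : ι → A → ℝ) (base : A → ℝ) (c : ι → ℝ) (x : ι → ℝ) : A → ℝ :=
  fun a => ∑ k, c k * x k * ψ k a + base a

/-- tilted log-partition ratio -/
def iL (ψ : ι → A → ℝ) (base f : A → ℝ) (c : ι → ℝ) (x : ι → ℝ) : ℝ :=
  lse (fun a => iV ψ base c x a + f a) - lse (iV ψ base c x)

lemma continuous_iV (ψ : ι → A → ℝ) (base : A → ℝ) (c : ι → ℝ) (a : A) :
    Continuous fun x => iV ψ base c x a := by
  unfold iV; fun_prop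

lemma continuous_iVf (ψ : ι → A → ℝ) (base f : A → ℝ) (c : ι → ℝ) (a : A) :
    Continuous fun x => iV ψ base c x a + f a := by
  unfold iV; fun_prop

lemma continuous_iL (ψ : ι → A → ℝ) (base f : A → ℝ) (c : ι → ℝ) :
    Continuous fun x => iL ψ base f c x :=
  (continuous_lse (continuous_iVf ψ base f c)).sub (continuous_lse (continuous_iV ψ base c))

lemma hasDerivAt_iV_update [DecidableEq ι] (ψ : ι → A → ℝ) (base : A → ℝ) (c : ι → ℝ) (x : ι → ℝ)
    (k : ι) (y : ℝ) (a : A) :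
    HasDerivAt (fun y => iV ψ base c (Function.update x k y) a) (c k * ψ k a) y := by
  unfold iV
  have h := hasDerivAt_pi.1 (hasDerivAt_update x k y)
  have h2 := HasDerivAt.fun_sum (u := Finset.univ)
    (fun j _ => (((h j).const_mul (c j)).mul_const (ψ j a)))
  refine (h2.add_const (base a)).congr_deriv ?_
  simp [Pi.single_apply]

/-- the bracket coming from integration by parts -/
def iBr (ψ : ι → A → ℝ) (base f : A → ℝ) (c : ι → ℝ) (p : ℝ) (k : ι) (x : ι → ℝ) : ℝ :=
  (gav (fun a => iV ψ base c x a + f a) (fun a => ψ k a * ψ k a)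
    - gav (fun a => iV ψ base c x a + f a) (ψ k) * gav (fun a => iV ψ base c x a + f a) (ψ k))
  - (gav (iV ψ base c x) (fun a => ψ k a * ψ k a)
    - gav (iV ψ base c x) (ψ k) * gav (iV ψ base c x) (ψ k))
  + p * (gav (fun a => iV ψ base c x a + f a) (ψ k) - gav (iV ψ base c x) (ψ k)) ^ 2

lemma interp_ibp [DecidableEq ι] (ψ : ι → A → ℝ) (base f : A → ℝ) (c : ι → ℝ) (p : ℝ) (k : ι) :
    Integrable (fun x => c k * (Real.exp (p * iL ψ base f c x) * iBr ψ base f c p k x))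
      (gamPi ι) ∧
    Integrable (fun x => x k * (Real.exp (p * iL ψ base f c x) *
      (gav (fun a => iV ψ base c x a + f a) (ψ k) - gav (iV ψ base c x) (ψ k)))) (gamPi ι) ∧
    ∫ x, x k * (Real.exp (p * iL ψ base f c x) *
      (gav (fun a => iV ψ base c x a + f a) (ψ k) - gav (iV ψ base c x) (ψ k))) ∂gamPi ι =
    ∫ x, c k * (Real.exp (p * iL ψ base f c x) * iBr ψ base f c p k x) ∂gamPi ι := by
  obtain ⟨M, hM⟩ : ∃ M : ℝ, ∀ a, |f a| ≤ M ∧ |ψ k a| ≤ M := by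
    refine ⟨∑ a, (|f a| + |ψ k a|), fun a => ?_⟩
    have := Finset.single_le_sum (f := fun a => |f a| + |ψ k a|)
      (fun a _ => by positivity) (Finset.mem_univ a)
    constructor <;> linarith [abs_nonneg (f a), abs_nonneg (ψ k a)]
  have hM0 : 0 ≤ M := (abs_nonneg _).trans (hM (Classical.arbitrary A)).1
  have hL : ∀ x, |iL ψ base f c x| ≤ M := fun x => lse_sub_abs_le fun a => (hM a).1
  have hE : ∀ x, Real.exp (p * iL ψ base f c x) ≤ Real.exp (|p| * M) := by
    intro x
    apply Real.exp_le_exp.2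
    calc p * iL ψ base f c x ≤ |p * iL ψ base f c x| := le_abs_self _
      _ = |p| * |iL ψ base f c x| := abs_mul _ _
      _ ≤ |p| * M := by gcongr; exact hL x
  have hg : ∀ u : A → ℝ, |gav u (ψ k)| ≤ M := fun u => gav_abs_le u fun a => (hM a).2
  have hg2 : ∀ u : A → ℝ, |gav u (fun a => ψ k a * ψ k a)| ≤ M * M := fun u =>
    gav_abs_le u fun a => by rw [abs_mul]; gcongr <;> exact (hM a).2
  have hgg : ∀ u v : A → ℝ, |gav u (ψ k) - gav v (ψ k)| ≤ 2 * M := fun u v => by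
    refine (abs_sub _ _).trans ?_
    linarith [hg u, hg v]
  have hvar : ∀ u : A → ℝ, |gav u (fun a => ψ k a * ψ k a) - gav u (ψ k) * gav u (ψ k)|
      ≤ 2 * (M * M) := fun u => by
    refine (abs_sub _ _).trans ?_
    have : |gav u (ψ k) * gav u (ψ k)| ≤ M * M := by rw [abs_mul]; gcongr <;> exact hg u
    linarith [hg2 u]
  have hB : ∀ x, |iBr ψ base f c p k x| ≤ 4 * (M * M) + |p| * (2 * M) ^ 2 := by
    intro x
    unfold iBr
    refine (abs_add_le _ _).trans ?_
    refine add_le_add ?_ ?_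
    · refine (abs_sub _ _).trans ?_
      linarith [hvar (iV ψ base c x), hvar (fun a => iV ψ base c x a + f a)]
    · rw [abs_mul, abs_pow]
      gcongr
      exact hgg _ _
  refine stein_pi k (C := Real.exp (|p| * M) * (2 * M) +
    |c k| * (Real.exp (|p| * M) * (4 * (M * M) + |p| * (2 * M) ^ 2))) ?_ ?_ ?_ ?_ ?_
  · intro x y
    have h1 := hasDerivAt_iV_update ψ base c x k y
    have h2 : ∀ a, HasDerivAt (fun y => iV ψ base c (Function.update x k y) a + f a)
        (c k * ψ k a) y := fun a => (h1 a).add_const (f a)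
    have d1 := (hasDerivAt_lse h2).sub (hasDerivAt_lse h1)
    have d2 := (hasDerivAt_gav h2 (ψ k)).sub (hasDerivAt_gav h1 (ψ k))
    have d3 := ((d1.const_mul p).exp).mul d2
    refine d3.congr_deriv ?_
    simp only [gav_const_mul, mul_left_comm _ (c k), iBr, iL, Pi.sub_apply]
    ring
  · have := continuous_iL ψ base f c
    have h1 := continuous_gav (ψ k) (continuous_iVf ψ base f c)
    have h2 := continuous_gav (ψ k) (continuous_iV ψ base c)
    fun_prop
  · have := continuous_iL ψ base f c
    have h1 := continuous_gav (ψ k) (continuous_iVf ψ base f c)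
    have h2 := continuous_gav (ψ k) (continuous_iV ψ base c)
    have h3 := continuous_gav (fun a => ψ k a * ψ k a) (continuous_iVf ψ base f c)
    have h4 := continuous_gav (fun a => ψ k a * ψ k a) (continuous_iV ψ base c)
    unfold iBr
    fun_prop
  · intro x
    rw [abs_mul, abs_of_pos (Real.exp_pos _)]
    have : Real.exp (p * iL ψ base f c x) *
      |gav (fun a => iV ψ base c x a + f a) (ψ k) - gav (iV ψ base c x) (ψ k)| ≤
        Real.exp (|p| * M) * (2 * M) := mul_le_mul (hE x) (hgg _ _) (abs_nonneg _) (Real.exp_pos _).le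
    have h0 : 0 ≤ |c k| * (Real.exp (|p| * M) * (4 * (M * M) + |p| * (2 * M) ^ 2)) := by positivity
    linarith
  · intro x
    rw [abs_mul, abs_mul, abs_of_pos (Real.exp_pos _)]
    have : |c k| * (Real.exp (p * iL ψ base f c x) * |iBr ψ base f c p k x|) ≤
        |c k| * (Real.exp (|p| * M) * (4 * (M * M) + |p| * (2 * M) ^ 2)) :=
      mul_le_mul_of_nonneg_left (mul_le_mul (hE x) (hB x) (abs_nonneg _) (Real.exp_pos _).le)
        (abs_nonneg _)
    have h0 : 0 ≤ Real.exp (|p| * M) * (2 * M) := by positivity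
    linarith

/-- derivative of the integrand in the interpolation parameter -/
def iD (ψ : ι → A → ℝ) (base f f1 : A → ℝ) (c c' : ι → ℝ) (p p' s' : ℝ) (x : ι → ℝ) : ℝ :=
  Real.exp (p * iL ψ base f c x) * (p' * iL ψ base f c x +
    p * (s' * gav (fun a => iV ψ base c x a + f a) f1 +
      ∑ k, c' k * x k * (gav (fun a => iV ψ base c x a + f a) (ψ k) - gav (iV ψ base c x) (ψ k))))

lemma iD_hasDerivAt (ψ : ι → A → ℝ) (base f0 f1 : A → ℝ) (c c' : ι → ℝ → ℝ) (p p' s s' : ℝ → ℝ)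
    (hc : ∀ k θ, HasDerivAt (c k) (c' k θ) θ) (hp : ∀ θ, HasDerivAt p (p' θ) θ)
    (hs : ∀ θ, HasDerivAt s (s' θ) θ) (x : ι → ℝ) (θ : ℝ) :
    HasDerivAt (fun θ => Real.exp (p θ * iL ψ base (fun a => s θ * f1 a + f0 a) (fun k => c k θ) x))
      (iD ψ base (fun a => s θ * f1 a + f0 a) f1 (fun k => c k θ) (fun k => c' k θ)
        (p θ) (p' θ) (s' θ) x) θ := by
  have h1 : ∀ a, HasDerivAt (fun θ => iV ψ base (fun k => c k θ) x a)
      (∑ k, c' k θ * x k * ψ k a) θ := by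
    intro a
    have := HasDerivAt.fun_sum (u := Finset.univ)
      (fun k _ => (((hc k θ).mul_const (x k)).mul_const (ψ k a)))
    exact this.add_const (base a)
  have h2 : ∀ a, HasDerivAt (fun θ => iV ψ base (fun k => c k θ) x a + (s θ * f1 a + f0 a))
      (∑ k, c' k θ * x k * ψ k a + s' θ * f1 a) θ := fun a =>
    (h1 a).fun_add (((hs θ).mul_const (f1 a)).add_const (f0 a))
  have d1 := (hasDerivAt_lse h2).fun_sub (hasDerivAt_lse h1)
  have d3 := ((hp θ).fun_mul d1).exp
  refine d3.congr_deriv ?_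
  simp only [gav_add, gav_sum, gav_const_mul, iD, iL]
  have e : ∀ u v : A → ℝ, ∑ k, c' k θ * x k * gav u (ψ k) - ∑ k, c' k θ * x k * gav v (ψ k) =
      ∑ k, c' k θ * x k * (gav u (ψ k) - gav v (ψ k)) := by
    intro u v
    rw [← Finset.sum_sub_distrib]
    refine Finset.sum_congr rfl fun k _ => by ring
  rw [← e]
  ring

lemma interp_hasDerivAt (ψ : ι → A → ℝ) (base f0 f1 : A → ℝ) (c c' : ι → ℝ → ℝ)
    (p p' s s' : ℝ → ℝ)
    (hc : ∀ k θ, HasDerivAt (c k) (c' k θ) θ) (hp : ∀ θ, HasDerivAt p (p' θ) θ)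
    (hs : ∀ θ, HasDerivAt s (s' θ) θ) (M : ℝ) (hc'b : ∀ k θ, |c' k θ| ≤ M)
    (hpb : ∀ θ, |p θ| ≤ M) (hp'b : ∀ θ, |p' θ| ≤ M) (hsb : ∀ θ, |s θ| ≤ M)
    (hs'b : ∀ θ, |s' θ| ≤ M) (θ₀ : ℝ) :
    HasDerivAt (fun θ => ∫ x, Real.exp (p θ * iL ψ base (fun a => s θ * f1 a + f0 a)
        (fun k => c k θ) x) ∂gamPi ι)
      (∫ x, iD ψ base (fun a => s θ₀ * f1 a + f0 a) f1 (fun k => c k θ₀) (fun k => c' k θ₀)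
        (p θ₀) (p' θ₀) (s' θ₀) x ∂gamPi ι) θ₀ := by
  classical
  obtain ⟨Q, hQ⟩ : ∃ Q : ℝ, ∀ a, |f0 a| ≤ Q ∧ |f1 a| ≤ Q ∧ ∀ k, |ψ k a| ≤ Q := by
    refine ⟨∑ a, (|f0 a| + |f1 a| + ∑ k, |ψ k a|), fun a => ?_⟩
    have := Finset.single_le_sum (f := fun a => |f0 a| + |f1 a| + ∑ k, |ψ k a|)
      (fun a _ => by positivity) (Finset.mem_univ a)
    have h0 : 0 ≤ ∑ k, |ψ k a| := by positivity
    refine ⟨by linarith [abs_nonneg (f0 a), abs_nonneg (f1 a)],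
      by linarith [abs_nonneg (f0 a), abs_nonneg (f1 a)], fun k => ?_⟩
    have h1 := Finset.single_le_sum (f := fun k => |ψ k a|)
      (fun a _ => by positivity) (Finset.mem_univ k)
    linarith [abs_nonneg (f0 a), abs_nonneg (f1 a)]
  have hQ0 : 0 ≤ Q := (abs_nonneg _).trans (hQ (Classical.arbitrary A)).1
  have hM0 : 0 ≤ M := (abs_nonneg _).trans (hpb 0)
  have hf : ∀ θ a, |s θ * f1 a + f0 a| ≤ M * Q + Q := fun θ a => by
    refine (abs_add_le _ _).trans ?_
    rw [abs_mul]
    have := (hQ a).1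
    have := (hQ a).2.1
    have := hsb θ
    gcongr
  set T := M * Q + Q with hT
  have hT0 : 0 ≤ T := by positivity
  have hL : ∀ θ x, |iL ψ base (fun a => s θ * f1 a + f0 a) (fun k => c k θ) x| ≤ T :=
    fun θ x => lse_sub_abs_le fun a => hf θ a
  have hE : ∀ θ x, Real.exp (p θ * iL ψ base (fun a => s θ * f1 a + f0 a) (fun k => c k θ) x)
      ≤ Real.exp (M * T) := by
    intro θ x
    apply Real.exp_le_exp.2
    refine (le_abs_self _).trans ?_
    rw [abs_mul]
    have := hpb θ
    have := hL θ x
    gcongr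
  have hD : ∀ θ x, |iD ψ base (fun a => s θ * f1 a + f0 a) f1 (fun k => c k θ) (fun k => c' k θ)
        (p θ) (p' θ) (s' θ) x| ≤
      Real.exp (M * T) * (M * T + M * (M * Q + ∑ k, M * |x k| * (2 * Q))) := by
    intro θ x
    unfold iD
    rw [abs_mul, abs_of_pos (Real.exp_pos _)]
    refine mul_le_mul (hE θ x) ?_ (abs_nonneg _) (Real.exp_pos _).le
    refine (abs_add_le _ _).trans ?_
    refine add_le_add ?_ ?_
    · rw [abs_mul]
      have := hp'b θ
      have := hL θ x
      gcongr
    · rw [abs_mul]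
      refine mul_le_mul (hpb θ) ?_ (abs_nonneg _) hM0
      refine (abs_add_le _ _).trans ?_
      refine add_le_add ?_ ?_
      · rw [abs_mul]
        exact mul_le_mul (hs'b θ) (gav_abs_le _ fun a => (hQ a).2.1) (abs_nonneg _) hM0
      · refine (Finset.abs_sum_le_sum_abs _ _).trans ?_
        refine Finset.sum_le_sum fun k _ => ?_
        rw [abs_mul, abs_mul]
        refine mul_le_mul (mul_le_mul_of_nonneg_right (hc'b k θ) (abs_nonneg _)) ?_
          (abs_nonneg _) (by positivity)
        refine (abs_sub _ _).trans ?_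
        have h1 := gav_abs_le (iV ψ base (fun k => c k θ) x) fun a => (hQ a).2.2 k
        have h2 := gav_abs_le (fun a => iV ψ base (fun k => c k θ) x a + (s θ * f1 a + f0 a))
          fun a => (hQ a).2.2 k
        linarith
  have cD : Continuous fun x => iD ψ base (fun a => s θ₀ * f1 a + f0 a) f1 (fun k => c k θ₀)
      (fun k => c' k θ₀) (p θ₀) (p' θ₀) (s' θ₀) x := by
    have h0 := continuous_iL ψ base (fun a => s θ₀ * f1 a + f0 a) (fun k => c k θ₀)
    have h1 := continuous_gav f1 (continuous_iVf ψ base (fun a => s θ₀ * f1 a + f0 a)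
      (fun k => c k θ₀))
    have h2 := fun k => continuous_gav (ψ k) (continuous_iVf ψ base
      (fun a => s θ₀ * f1 a + f0 a) (fun k => c k θ₀))
    have h3 := fun k => continuous_gav (ψ k) (continuous_iV ψ base (fun k => c k θ₀))
    unfold iD
    fun_prop
  have cE : ∀ θ, Continuous fun x => Real.exp (p θ * iL ψ base (fun a => s θ * f1 a + f0 a)
      (fun k => c k θ) x) := fun θ => by
    have h0 := continuous_iL ψ base (fun a => s θ * f1 a + f0 a) (fun k => c k θ)
    fun_prop
  refine (hasDerivAt_integral_of_dominated_loc_of_deriv_le (Metric.ball_mem_nhds θ₀ one_pos)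
    (F := fun θ x => Real.exp (p θ * iL ψ base (fun a => s θ * f1 a + f0 a) (fun k => c k θ) x))
    (F' := fun θ x => iD ψ base (fun a => s θ * f1 a + f0 a) f1 (fun k => c k θ)
      (fun k => c' k θ) (p θ) (p' θ) (s' θ) x)
    (bound := fun x => Real.exp (M * T) * (M * T + M * (M * Q + ∑ k, M * |x k| * (2 * Q))))
    (Filter.Eventually.of_forall fun θ => (cE θ).aestronglyMeasurable) ?_
    cD.aestronglyMeasurable ?_ ?_ ?_).2
  · refine Integrable.of_bound (cE θ₀).aestronglyMeasurable (Real.exp (M * T)) ?_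
    refine Filter.Eventually.of_forall fun x => ?_
    rw [Real.norm_eq_abs, abs_of_pos (Real.exp_pos _)]
    exact hE θ₀ x
  · exact Filter.Eventually.of_forall fun x θ _ => hD θ x
  · refine Integrable.const_mul (Integrable.add (integrable_const _) (Integrable.const_mul
      (Integrable.add (integrable_const _) ?_) _)) _
    refine integrable_finsetSum _ fun k _ => ?_
    exact ((integrable_coord k).abs.const_mul M).mul_const _
  · exact Filter.Eventually.of_forall fun x θ _ =>
      iD_hasDerivAt ψ base f0 f1 c c' p p' s s' hc hp hs x θ

lemma iD_integral (ψ : ι → A → ℝ) (base f f1 : A → ℝ) (c c' : ι → ℝ) (p p' s' : ℝ)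
    (hneg : ∀ x, p' * iL ψ base f c x + p * (s' * gav (fun a => iV ψ base c x a + f a) f1 +
      ∑ k, c' k * c k * iBr ψ base f c p k x) ≤ 0) :
    ∫ x, iD ψ base f f1 c c' p p' s' x ∂gamPi ι ≤ 0 := by
  classical
  obtain ⟨Q, hQ⟩ : ∃ Q : ℝ, ∀ a, |f a| ≤ Q ∧ |f1 a| ≤ Q := by
    refine ⟨∑ a, (|f a| + |f1 a|), fun a => ?_⟩
    have := Finset.single_le_sum (f := fun a => |f a| + |f1 a|)
      (fun a _ => by positivity) (Finset.mem_univ a)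
    constructor <;> linarith [abs_nonneg (f a), abs_nonneg (f1 a)]
  have hQ0 : 0 ≤ Q := (abs_nonneg _).trans (hQ (Classical.arbitrary A)).1
  have hL : ∀ x, |iL ψ base f c x| ≤ Q := fun x => lse_sub_abs_le fun a => (hQ a).1
  have hE : ∀ x, Real.exp (p * iL ψ base f c x) ≤ Real.exp (|p| * Q) := by
    intro x
    apply Real.exp_le_exp.2
    refine (le_abs_self _).trans ?_
    rw [abs_mul]
    gcongr; exact hL x
  have cL := continuous_iL ψ base f c
  have cg := continuous_gav f1 (continuous_iVf ψ base f c)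
  have I1 : Integrable (fun x => Real.exp (p * iL ψ base f c x) * (p' * iL ψ base f c x +
      p * (s' * gav (fun a => iV ψ base c x a + f a) f1))) (gamPi ι) := by
    refine Integrable.of_bound (by fun_prop)
      (Real.exp (|p| * Q) * (|p'| * Q + |p| * (|s'| * Q))) ?_
    refine Filter.Eventually.of_forall fun x => ?_
    rw [Real.norm_eq_abs, abs_mul, abs_of_pos (Real.exp_pos _)]
    refine mul_le_mul (hE x) ?_ (abs_nonneg _) (Real.exp_pos _).le
    refine (abs_add_le _ _).trans ?_
    rw [abs_mul, abs_mul, abs_mul]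
    have := gav_abs_le (fun a => iV ψ base c x a + f a) fun a => (hQ a).2
    have := hL x
    gcongr
  have ibp := interp_ibp ψ base f c p
  have I2 : ∀ k ∈ Finset.univ, Integrable (fun x => p * c' k *
      (x k * (Real.exp (p * iL ψ base f c x) *
      (gav (fun a => iV ψ base c x a + f a) (ψ k) - gav (iV ψ base c x) (ψ k)))))
      (gamPi ι) := fun k _ => (ibp k).2.1.const_mul _
  have I3 : ∀ k ∈ Finset.univ, Integrable (fun x => p * c' k *
      (c k * (Real.exp (p * iL ψ base f c x) * iBr ψ base f c p k x)))
      (gamPi ι) := fun k _ => (ibp k).1.const_mul _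
  have e1 : ∀ x, iD ψ base f f1 c c' p p' s' x =
      Real.exp (p * iL ψ base f c x) * (p' * iL ψ base f c x +
      p * (s' * gav (fun a => iV ψ base c x a + f a) f1)) +
      ∑ k, p * c' k * (x k * (Real.exp (p * iL ψ base f c x) *
      (gav (fun a => iV ψ base c x a + f a) (ψ k) - gav (iV ψ base c x) (ψ k)))) := by
    intro x
    unfold iD
    rw [mul_add p, ← add_assoc, mul_add (Real.exp _), Finset.mul_sum, Finset.mul_sum]
    congr 1
    refine Finset.sum_congr rfl fun k _ => by ring
  simp only [e1]
  rw [integral_add I1 (integrable_finsetSum _ I2), integral_finsetSum _ I2]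
  have e2 : ∀ k, ∫ x, p * c' k * (x k * (Real.exp (p * iL ψ base f c x) *
      (gav (fun a => iV ψ base c x a + f a) (ψ k) - gav (iV ψ base c x) (ψ k)))) ∂gamPi ι =
      ∫ x, p * c' k * (c k * (Real.exp (p * iL ψ base f c x) * iBr ψ base f c p k x)) ∂gamPi ι :=
    fun k => by rw [integral_const_mul, (ibp k).2.2, ← integral_const_mul]
  simp only [e2]
  rw [← integral_finsetSum _ I3, ← integral_add I1 (integrable_finsetSum _ I3)]
  refine integral_nonpos fun x => ?_
  have e3 : Real.exp (p * iL ψ base f c x) * (p' * iL ψ base f c x +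
      p * (s' * gav (fun a => iV ψ base c x a + f a) f1)) +
      ∑ k, p * c' k * (c k * (Real.exp (p * iL ψ base f c x) * iBr ψ base f c p k x)) =
      Real.exp (p * iL ψ base f c x) * (p' * iL ψ base f c x +
        p * (s' * gav (fun a => iV ψ base c x a + f a) f1 +
      ∑ k, c' k * c k * iBr ψ base f c p k x)) := by
    symm
    rw [mul_add p, ← add_assoc, mul_add (Real.exp _), Finset.mul_sum, Finset.mul_sum]
    congr 1
    refine Finset.sum_congr rfl fun k _ => by ring
  show _ ≤ (0 : ℝ)
  rw [e3]
  exact mul_nonpos_of_nonneg_of_nonpos (Real.exp_pos _).le (hneg x)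

end interp

/-! ### Two-replica interpolation -/

section twoReplica
variable {B : Type*} [Fintype B] [Nonempty B] {ι : Type*} [Fintype ι]

def pairSum (φ : B → ℝ) : B × B → ℝ := fun a => φ a.1 + φ a.2

lemma iV_pair (φ : ι → B → ℝ) (b : B → ℝ) (c x : ι → ℝ) :
    iV (fun k => pairSum (φ k)) (pairSum b) c x = pairW (iV φ b c x) := by
  funext a
  simp only [iV, pairSum, pairW, mul_add, Finset.sum_add_distrib]
  ring

lemma gav_prod_sum (u v : B × B → ℝ) (e : ι → ℝ) (ψ : ι → B × B → ℝ) :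
    ∑ k, e k * (gav u (ψ k) * gav v (ψ k)) =
      gav u (fun a => gav v (fun a' => ∑ k, e k * (ψ k a * ψ k a'))) := by
  simp only [gav_sum, gav_const_mul]
  refine Finset.sum_congr rfl fun k _ => ?_
  rw [gav_mul_const]

lemma bracket_le (φ : ι → B → ℝ) (e : ι → ℝ) (ρ : B → B → ℝ) (κ q d p : ℝ)
    (hκ : 0 ≤ κ) (hp0 : 0 ≤ p) (hp1 : p ≤ 1) (hρ : ∀ σ τ, 0 ≤ ρ σ τ)
    (hd : ∀ σ, ρ σ σ = d) (hsymm : ∀ σ τ, ρ σ τ = ρ τ σ)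
    (he : ∀ σ τ, ∑ k, e k * (φ k σ * φ k τ) = κ * (ρ σ τ - q ^ 2))
    (b : B → ℝ) (f : B × B → ℝ) (c x : ι → ℝ) :
    ∑ k, e k * iBr (fun k => pairSum (φ k)) (pairSum b) f c p k x ≤
      2 * κ * (gav (fun a => iV (fun k => pairSum (φ k)) (pairSum b) c x a + f a)
          (fun a => ρ a.1 a.2) +
        (1 + 2 * p) * gav (iV (fun k => pairSum (φ k)) (pairSum b) c x) (fun a => ρ a.1 a.2)) := by
  set u : B × B → ℝ := iV (fun k => pairSum (φ k)) (pairSum b) c x with hu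
  set v : B × B → ℝ := fun a => u a + f a with hv
  set E : B × B → B × B → ℝ := fun a a' => ρ a.1 a'.1 + ρ a.1 a'.2 + ρ a.2 a'.1 + ρ a.2 a'.2 with hE
  have hE0 : ∀ a a', 0 ≤ E a a' := fun a a' => by
    have h1 := hρ a.1 a'.1
    have h2 := hρ a.1 a'.2
    have h3 := hρ a.2 a'.1
    have h4 := hρ a.2 a'.2
    simp only [hE]; linarith
  have key : ∀ a a', ∑ k, e k * (pairSum (φ k) a * pairSum (φ k) a') =
      κ * E a a' - 4 * κ * q ^ 2 := by
    intro a a'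
    have : ∀ k, e k * (pairSum (φ k) a * pairSum (φ k) a') =
      e k * (φ k a.1 * φ k a'.1) + e k * (φ k a.1 * φ k a'.2) +
      e k * (φ k a.2 * φ k a'.1) + e k * (φ k a.2 * φ k a'.2) := fun k => by
        simp only [pairSum]; ring
    simp only [this, Finset.sum_add_distrib, he, hE]
    ring
  have dbl : ∀ w w' : B × B → ℝ, ∑ k, e k * (gav w (pairSum (φ k)) * gav w' (pairSum (φ k))) =
      κ * gav w (fun a => gav w' (fun a' => E a a')) - 4 * κ * q ^ 2 := by
    intro w w'
    rw [gav_prod_sum]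
    simp only [key, gav_sub, gav_const_mul, gav_const]
  have diag : ∀ w : B × B → ℝ, ∑ k, e k * gav w (fun a => pairSum (φ k) a * pairSum (φ k) a) =
      κ * (2 * d + 2 * gav w (fun a => ρ a.1 a.2)) - 4 * κ * q ^ 2 := by
    intro w
    simp only [← gav_const_mul, ← gav_sum, key]
    have : ∀ a : B × B, E a a = 2 * d + 2 * ρ a.1 a.2 := fun a => by
      simp only [hE, hd, hsymm a.2 a.1]; ring
    simp only [gav_sub, gav_const_mul, gav_const, this, gav_add]
  have e00 : gav u (fun a => gav u (fun a' => E a a')) = 4 * gav u (fun a => ρ a.1 a.2) := by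
    rw [hu, iV_pair]
    set w := iV φ b c x
    have : ∀ a, gav (pairW w) (fun a' => E a a') =
        2 * gav w (fun y => ρ a.1 y) + 2 * gav w (fun y => ρ a.2 y) := by
      intro a
      simp only [hE, gav_add]
      rw [gav_pair_fst w (fun y => ρ a.1 y), gav_pair_snd w (fun y => ρ a.1 y),
        gav_pair_fst w (fun y => ρ a.2 y), gav_pair_snd w (fun y => ρ a.2 y)]
      ring
    simp only [this, gav_add, gav_const_mul]
    rw [gav_pair_fst w (fun z => gav w (fun y => ρ z y)),
      gav_pair_snd w (fun z => gav w (fun y => ρ z y)), gav_pair w ρ]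
    ring
  have Eff : 0 ≤ gav v (fun a => gav v (fun a' => E a a')) :=
    gav_nonneg _ fun a => gav_nonneg _ fun a' => hE0 a a'
  have Ef0 : 0 ≤ gav v (fun a => gav u (fun a' => E a a')) :=
    gav_nonneg _ fun a => gav_nonneg _ fun a' => hE0 a a'
  have X0 : 0 ≤ gav u (fun a => ρ a.1 a.2) := gav_nonneg _ fun a => hρ _ _
  have tot : ∑ k, e k * iBr (fun k => pairSum (φ k)) (pairSum b) f c p k x =
      (∑ k, e k * gav v (fun a => pairSum (φ k) a * pairSum (φ k) a)
        - ∑ k, e k * gav u (fun a => pairSum (φ k) a * pairSum (φ k) a))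
      - (1 - p) * ∑ k, e k * (gav v (pairSum (φ k)) * gav v (pairSum (φ k)))
      - 2 * p * ∑ k, e k * (gav v (pairSum (φ k)) * gav u (pairSum (φ k)))
      + (1 + p) * ∑ k, e k * (gav u (pairSum (φ k)) * gav u (pairSum (φ k))) := by
    simp only [Finset.mul_sum, ← Finset.sum_sub_distrib, ← Finset.sum_add_distrib]
    refine Finset.sum_congr rfl fun k _ => ?_
    simp only [iBr, ← hu, ← hv]
    ring
  rw [tot, dbl, dbl, dbl, diag, diag, e00]
  have h1 : 0 ≤ (1 - p) * (κ * gav v (fun a => gav v (fun a' => E a a'))) := by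
    have : 0 ≤ 1 - p := by linarith
    positivity
  have h2 : 0 ≤ 2 * p * (κ * gav v (fun a => gav u (fun a' => E a a'))) := by positivity
  nlinarith [h1, h2]

variable {ι1 ι2 : Type*} [Fintype ι1] [Fintype ι2]

/-- interpolation coefficients -/
def cI (θ : ℝ) : ι1 ⊕ ι2 → ℝ := Sum.elim (fun _ => Real.sin θ) (fun _ => Real.cos θ)

lemma main_interp (φ : ι1 ⊕ ι2 → B → ℝ) (ρ : B → B → ℝ) (n β q d s0 : ℝ)
    (hn : 0 ≤ n) (hρ : ∀ σ τ, 0 ≤ ρ σ τ)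
    (hd : ∀ σ, ρ σ σ = d) (hsymm : ∀ σ τ, ρ σ τ = ρ τ σ) (hs : β ^ 2 < s0)
    (he : ∀ σ τ, ∑ k, φ (Sum.inl k) σ * φ (Sum.inl k) τ -
      ∑ k, φ (Sum.inr k) σ * φ (Sum.inr k) τ = β ^ 2 * n / 2 * (ρ σ τ - q ^ 2))
    (b : B → ℝ) (f0 : B × B → ℝ) (hf0 : ∀ a, 0 ≤ f0 a) :
    ∫ x, Real.exp (Real.exp (-(3 * β ^ 2 / (s0 - β ^ 2))) *
      iL (fun k => pairSum (φ k)) (pairSum b)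
        (fun a => (s0 - β ^ 2) * (n / 2 * ρ a.1 a.2) + f0 a) (cI (Real.pi / 2)) x)
        ∂gamPi (ι1 ⊕ ι2) ≤
    ∫ x, Real.exp (iL (fun k => pairSum (φ k)) (pairSum b)
        (fun a => s0 * (n / 2 * ρ a.1 a.2) + f0 a) (cI 0) x) ∂gamPi (ι1 ⊕ ι2) := by
  set cc := 3 * β ^ 2 / (s0 - β ^ 2) with hcc
  have hs1 : 0 < s0 - β ^ 2 := by linarith
  have hcc0 : 0 ≤ cc := by positivity
  have hccs : cc * (s0 - β ^ 2) = 3 * β ^ 2 := by rw [hcc]; field_simp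
  set p : ℝ → ℝ := fun θ => Real.exp (-(cc * Real.sin θ ^ 2)) with hp
  set p' : ℝ → ℝ := fun θ => -(2 * cc * (Real.sin θ * Real.cos θ)) * p θ with hp'
  set s : ℝ → ℝ := fun θ => s0 - β ^ 2 * Real.sin θ ^ 2 with hsd
  set s' : ℝ → ℝ := fun θ => -(2 * β ^ 2 * (Real.sin θ * Real.cos θ)) with hs'
  set c' : ι1 ⊕ ι2 → ℝ → ℝ := fun k θ =>
    Sum.elim (fun _ => Real.cos θ) (fun _ => - Real.sin θ) k with hc'
  set e : ι1 ⊕ ι2 → ℝ := Sum.elim (fun _ => 1) (fun _ => -1) with hee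
  set f1 : B × B → ℝ := fun a => n / 2 * ρ a.1 a.2 with hf1
  have hsin1 : ∀ θ, Real.sin θ ^ 2 ≤ 1 := Real.sin_sq_le_one
  have hpos : ∀ θ, 0 ≤ p θ := fun θ => (Real.exp_pos _).le
  have hp1 : ∀ θ, p θ ≤ 1 := fun θ => by
    apply Real.exp_le_one_iff.2
    have : 0 ≤ cc * Real.sin θ ^ 2 := by positivity
    linarith
  have hsc : ∀ θ, |Real.sin θ * Real.cos θ| ≤ 1 := fun θ => by
    rw [abs_mul]
    exact mul_le_one₀ (Real.abs_sin_le_one θ) (abs_nonneg _) (Real.abs_cos_le_one θ)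
  have dsin2 : ∀ θ, HasDerivAt (fun θ => Real.sin θ ^ 2) (2 * (Real.sin θ * Real.cos θ)) θ :=
    fun θ => ((Real.hasDerivAt_sin θ).fun_pow 2).congr_deriv (by ring)
  have dc : ∀ k θ, HasDerivAt (fun θ => (cI θ : ι1 ⊕ ι2 → ℝ) k) (c' k θ) θ := by
    rintro (k | k) θ
    · exact Real.hasDerivAt_sin θ
    · exact Real.hasDerivAt_cos θ
  have dp : ∀ θ, HasDerivAt p (p' θ) θ := fun θ =>
    (((dsin2 θ).const_mul cc).fun_neg.exp).congr_deriv (by simp only [hp', hp]; ring)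
  have ds : ∀ θ, HasDerivAt s (s' θ) θ := fun θ =>
    (((dsin2 θ).const_mul (β ^ 2)).const_sub s0).congr_deriv (by simp only [hs']; ring)
  set M := 1 + 2 * cc + |s0| + 2 * β ^ 2 with hM
  have D := interp_hasDerivAt (fun k => pairSum (φ k)) (pairSum b) f0 f1
    (fun k θ => (cI θ : ι1 ⊕ ι2 → ℝ) k) c' p p' s s' dc dp ds M
    (by
      have h0 : (1 : ℝ) ≤ M := by
        have := abs_nonneg s0
        have := sq_nonneg β
        linarith
      rintro (k | k) θ
      · exact (Real.abs_cos_le_one θ).trans h0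
      · simp only [hc', Sum.elim_inr, abs_neg]
        exact (Real.abs_sin_le_one θ).trans h0)
    (fun θ => by
      rw [abs_of_nonneg (hpos θ)]
      have := hp1 θ
      have := abs_nonneg s0
      have := sq_nonneg β
      linarith)
    (fun θ => by
      simp only [hp']
      rw [abs_mul, abs_neg, abs_mul, abs_of_nonneg (hpos θ), abs_of_nonneg (by positivity : 0 ≤ 2 * cc)]
      have h1 : 2 * cc * |Real.sin θ * Real.cos θ| * p θ ≤ 2 * cc * 1 * 1 := by
        gcongr
        · exact hsc θ
        · exact hp1 θ
      have := abs_nonneg s0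
      have := sq_nonneg β
      linarith)
    (fun θ => by
      have h1 : |s θ| ≤ |s0| + |β ^ 2 * Real.sin θ ^ 2| := abs_sub _ _
      rw [abs_of_nonneg (by positivity : 0 ≤ β ^ 2 * Real.sin θ ^ 2)] at h1
      have := mul_le_mul_of_nonneg_left (hsin1 θ) (sq_nonneg β)
      have := sq_nonneg β
      linarith)
    (fun θ => by
      simp only [hs']
      rw [abs_neg, abs_mul, abs_of_nonneg (by positivity : 0 ≤ 2 * β ^ 2)]
      have := mul_le_mul_of_nonneg_left (hsc θ) (by positivity : 0 ≤ 2 * β ^ 2)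
      have := abs_nonneg s0
      linarith)
  have Dneg : ∀ θ ∈ Set.Icc 0 (Real.pi / 2), ∫ x, iD (fun k => pairSum (φ k)) (pairSum b)
      (fun a => s θ * f1 a + f0 a) f1 (cI θ) (fun k => c' k θ)
        (p θ) (p' θ) (s' θ) x ∂gamPi (ι1 ⊕ ι2) ≤ 0 := by
    intro θ hθ
    apply iD_integral
    intro x
    have hsin : 0 ≤ Real.sin θ := Real.sin_nonneg_of_nonneg_of_le_pi hθ.1
      (by linarith [hθ.2, Real.pi_pos])
    have hcos : 0 ≤ Real.cos θ := Real.cos_nonneg_of_neg_pi_div_two_le_of_le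
      (by linarith [hθ.1, Real.pi_pos]) hθ.2
    set t := Real.sin θ * Real.cos θ with ht
    have ht0 : 0 ≤ t := mul_nonneg hsin hcos
    have br := bracket_le φ e ρ (β ^ 2 * n / 2) q d (p θ) (by positivity) (hpos θ) (hp1 θ) hρ hd
      hsymm (by
        intro σ τ
        rw [← he σ τ, Fintype.sum_sum_type]
        simp only [hee, Sum.elim_inl, Sum.elim_inr, one_mul, neg_one_mul, Finset.sum_neg_distrib]
        ring) b (fun a => s θ * f1 a + f0 a) (cI θ) x
    have hsum : ∑ k, c' k θ * (cI θ : ι1 ⊕ ι2 → ℝ) k * iBr (fun k => pairSum (φ k)) (pairSum b)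
        (fun a => s θ * f1 a + f0 a) (cI θ) (p θ) k x =
        t * ∑ k, e k * iBr (fun k => pairSum (φ k)) (pairSum b)
        (fun a => s θ * f1 a + f0 a) (cI θ) (p θ) k x := by
      rw [Finset.mul_sum]
      refine Finset.sum_congr rfl fun k _ => ?_
      rcases k with k | k <;> simp only [hc', cI, hee, Sum.elim_inl, Sum.elim_inr, ht] <;> ring
    rw [hsum]
    set V := iV (fun k => pairSum (φ k)) (pairSum b) (cI θ) x with hV
    set Vf : B × B → ℝ := fun a => V a + (s θ * f1 a + f0 a) with hVf
    set Xf := gav Vf (fun a => ρ a.1 a.2) with hXf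
    set X0 := gav V (fun a => ρ a.1 a.2) with hX0
    have hX00 : 0 ≤ X0 := gav_nonneg _ fun a => hρ _ _
    have hgf1 : gav Vf f1 = n / 2 * Xf := gav_const_mul _ _ _
    have hL : (s0 - β ^ 2) * (n / 2 * X0) ≤
        iL (fun k => pairSum (φ k)) (pairSum b) (fun a => s θ * f1 a + f0 a) (cI θ) x := by
      have h1 := gav_le_lse V (fun a => s θ * f1 a + f0 a)
      refine le_trans ?_ h1
      rw [gav_add, gav_const_mul]
      have h2 : gav V f1 = n / 2 * X0 := gav_const_mul _ _ _
      rw [h2]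
      have h3 : 0 ≤ gav V f0 := gav_nonneg _ hf0
      have h4 : s0 - β ^ 2 ≤ s θ := by
        simp only [hsd]
        nlinarith [hsin1 θ, sq_nonneg β]
      have h5 : 0 ≤ n / 2 * X0 := by positivity
      nlinarith
    set LL := iL (fun k => pairSum (φ k)) (pairSum b) (fun a => s θ * f1 a + f0 a) (cI θ) x
    rw [hgf1]
    set SB := ∑ k, e k * iBr (fun k => pairSum (φ k)) (pairSum b)
        (fun a => s θ * f1 a + f0 a) (cI θ) (p θ) k x
    have h1 : t * SB ≤ t * (β ^ 2 * n * (Xf + 3 * X0)) := by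
      refine mul_le_mul_of_nonneg_left (br.trans ?_) ht0
      have : (1 + 2 * p θ) * X0 ≤ 3 * X0 :=
        mul_le_mul_of_nonneg_right (by linarith [hp1 θ]) hX00
      have h0 : 0 ≤ β ^ 2 * n := by positivity
      calc 2 * (β ^ 2 * n / 2) * (Xf + (1 + 2 * p θ) * X0)
          = β ^ 2 * n * (Xf + (1 + 2 * p θ) * X0) := by ring
        _ ≤ _ := by gcongr
    have h2 : s' θ * (n / 2 * Xf) + t * SB ≤ 3 * t * β ^ 2 * n * X0 := by
      simp only [hs']
      linarith
    have h3 : p' θ * LL ≤ -(p θ * (3 * t * β ^ 2 * n * X0)) := by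
      simp only [hp']
      have h4 : 0 ≤ 2 * cc * t * p θ := by
        have := hpos θ
        positivity
      have h5 := mul_le_mul_of_nonneg_left hL h4
      have h6 : 2 * cc * t * p θ * ((s0 - β ^ 2) * (n / 2 * X0)) =
        p θ * (t * (cc * (s0 - β ^ 2)) * n * X0) := by ring
      rw [h6, hccs] at h5
      linarith
    have h7 := mul_le_mul_of_nonneg_left h2 (hpos θ)
    linarith
  have anti : AntitoneOn (fun θ => ∫ x, Real.exp (p θ * iL (fun k => pairSum (φ k)) (pairSum b)
      (fun a => s θ * f1 a + f0 a) (cI θ) x) ∂gamPi (ι1 ⊕ ι2)) (Set.Icc 0 (Real.pi / 2)) := by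
    refine antitoneOn_of_deriv_nonpos (convex_Icc _ _)
      (fun θ _ => (D θ).continuousAt.continuousWithinAt)
      (fun θ _ => (D θ).differentiableAt.differentiableWithinAt) ?_
    intro θ hθ
    rw [(D θ).deriv]
    exact Dneg θ (interior_subset hθ)
  have fin := anti (Set.left_mem_Icc.2 (by positivity)) (Set.right_mem_Icc.2 (by positivity))
    (by positivity : (0 : ℝ) ≤ Real.pi / 2)
  simpa [p, s] using fin

end twoReplica

/-! ### Elementary tools -/

lemma tanh_hasDerivAt (x : ℝ) : HasDerivAt Real.tanh (1 - Real.tanh x ^ 2) x := by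
  have h : Real.tanh = fun y => Real.sinh y / Real.cosh y := by
    funext y; exact Real.tanh_eq_sinh_div_cosh y
  have hc := (Real.cosh_pos x).ne'
  have := (Real.hasDerivAt_sinh x).fun_div (Real.hasDerivAt_cosh x) hc
  rw [h]
  refine this.congr_deriv ?_
  field_simp

lemma tanh_continuous : Continuous Real.tanh :=
  continuous_iff_continuousAt.2 fun y => (tanh_hasDerivAt y).continuousAt

lemma integrable_expsq {s : ℝ} (hs : s < 1) :
    Integrable (fun ξ : ℝ => Real.exp (s * ξ ^ 2 / 2)) gam := by
  rw [gam, gaussianReal_of_var_ne_zero 0 (by norm_num : (1 : NNReal) ≠ 0),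
    integrable_withDensity_iff_integrable_smul' (measurable_gaussianPDF 0 1)
      (Filter.Eventually.of_forall fun x => ENNReal.ofReal_lt_top)]
  have : Integrable (fun x : ℝ => (Real.sqrt (2 * Real.pi))⁻¹ *
      Real.exp (-((1 - s) / 2) * x ^ 2)) :=
    (integrable_exp_neg_mul_sq (by linarith)).const_mul _
  refine this.congr (Filter.Eventually.of_forall fun x => ?_)
  simp only [toReal_gaussianPDF, gaussianPDFReal, smul_eq_mul, NNReal.coe_one, mul_one, sub_zero]
  rw [mul_assoc, ← Real.exp_add]
  congr 2
  ring

lemma gam_mgf (a : ℝ) : ∫ ξ, Real.exp (a * ξ) ∂gam = Real.exp (a ^ 2 / 2) := by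
  have := mgf_gaussianReal (p := gam) (X := id) (μ := 0) (v := 1) (by simp) a
  simpa [mgf] using this

/-- Hubbard–Stratonovich bound. -/
lemma hs_bound {A : Type*} [Fintype A] (P S : A → ℝ) (n s : ℝ) (hn : 0 < n) (hs0 : 0 ≤ s)
    (hs : s < 1) (h : ∀ t : ℝ, ∑ a, Real.exp (t * S a) * P a ≤ Real.exp (n * t ^ 2 / 2)) :
    ∑ a, Real.exp (s * S a ^ 2 / (2 * n)) * P a ≤ ∫ ξ, Real.exp (s * ξ ^ 2 / 2) ∂gam := by
  set r := Real.sqrt (s / n) with hr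
  have hr2 : r ^ 2 = s / n := Real.sq_sqrt (by positivity)
  have i0 : ∀ a ∈ Finset.univ, Integrable (fun ξ => Real.exp ((r * ξ) * S a) * P a) gam := by
    intro a _
    have := (integrable_exp_mul_gaussianReal (μ := 0) (v := 1) (r * S a)).mul_const (P a)
    refine this.congr (Filter.Eventually.of_forall fun ξ => ?_)
    simp only
    congr 2; ring
  calc ∑ a, Real.exp (s * S a ^ 2 / (2 * n)) * P a
      = ∑ a, ∫ ξ, Real.exp ((r * ξ) * S a) * P a ∂gam := by
        refine Finset.sum_congr rfl fun a _ => ?_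
        rw [integral_mul_const]
        congr 1
        have := gam_mgf (r * S a)
        rw [mul_pow, hr2] at this
        have e : s * S a ^ 2 / (2 * n) = s / n * S a ^ 2 / 2 := by field_simp
        rw [e, ← this]
        congr 1; funext ξ; congr 1; ring
    _ = ∫ ξ, ∑ a, Real.exp ((r * ξ) * S a) * P a ∂gam := (integral_finsetSum _ i0).symm
    _ ≤ ∫ ξ, Real.exp (s * ξ ^ 2 / 2) ∂gam := by
        refine integral_mono (integrable_finsetSum _ i0) (integrable_expsq hs) fun ξ => ?_
        refine (h (r * ξ)).trans (le_of_eq ?_)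
        rw [mul_pow, hr2]
        congr 1
        field_simp

/-- Two-point Hoeffding inequality. -/
lemma two_point (q t : ℝ) (h1 : -1 ≤ q) (h2 : q ≤ 1) :
    Real.cosh t + Real.sinh t * q ≤ Real.exp (t * q + t ^ 2 / 2) := by
  set a : NNReal := ⟨(1 + q) / 2, by linarith⟩ with ha
  set b : NNReal := ⟨(1 - q) / 2, by linarith⟩ with hb
  set μ : Measure ℝ := a • Measure.dirac 1 + b • Measure.dirac (-1) with hμ
  have hab : a + b = 1 := by
    apply NNReal.coe_injective
    rw [NNReal.coe_add]
    change (1 + q) / 2 + (1 - q) / 2 = (1 : ℝ)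
    ring
  have hi : ∀ f : ℝ → ℝ, ∫ x, f x ∂μ = (1 + q) / 2 * f 1 + (1 - q) / 2 * f (-1) := by
    intro f
    rw [hμ, integral_add_measure, integral_smul_nnreal_measure, integral_smul_nnreal_measure,
      integral_dirac, integral_dirac]
    · rfl
    · exact (integrable_dirac (by simp)).smul_measure_nnreal
    · exact (integrable_dirac (by simp)).smul_measure_nnreal
  have : IsProbabilityMeasure μ := ⟨by
    simp only [hμ, Measure.add_apply, Measure.smul_apply, measure_univ]
    have : ((a + b : NNReal) : ENNReal) = 1 := by rw [hab]; rfl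
    rw [ENNReal.coe_add] at this
    simpa [ENNReal.smul_def] using this⟩
  have hsub := hasSubgaussianMGF_of_mem_Icc (μ := μ) (X := fun x => x) (a := -1) (b := 1)
    aemeasurable_id (by
      rw [hμ, ae_add_measure_iff]
      constructor
      · refine Measure.ae_smul_measure ?_ a
        rw [ae_dirac_eq]; change _ ∧ _; norm_num
      · refine Measure.ae_smul_measure ?_ b
        rw [ae_dirac_eq]; change _ ∧ _; norm_num)
  have hm := hsub.mgf_le t
  have hmean : ∫ x, x ∂μ = q := by rw [hi (fun x => x)]; ring
  rw [hmean] at hm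
  simp only [mgf] at hm
  rw [hi (fun x => Real.exp (t * (x - q)))] at hm
  have e1 : Real.cosh t + Real.sinh t * q = Real.exp (t * q) *
      ((1 + q) / 2 * Real.exp (t * (1 - q)) + (1 - q) / 2 * Real.exp (t * (-1 - q))) := by
    rw [Real.cosh_eq, Real.sinh_eq]
    have e2 : Real.exp (t * q) * Real.exp (t * (1 - q)) = Real.exp t := by
      rw [← Real.exp_add]; congr 1; ring
    have e3 : Real.exp (t * q) * Real.exp (t * (-1 - q)) = Real.exp (-t) := by
      rw [← Real.exp_add]; congr 1; ring
    have e4 : ∀ A B C : ℝ, A * ((1 + q) / 2 * B + (1 - q) / 2 * C) =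
      (1 + q) / 2 * (A * B) + (1 - q) / 2 * (A * C) := fun A B C => by ring
    rw [e4, e2, e3]; ring
  rw [e1, Real.exp_add]
  refine mul_le_mul_of_nonneg_left (hm.trans ?_) (Real.exp_pos _).le
  apply Real.exp_le_exp.2
  have : ((‖(1 : ℝ) - -1‖₊ / 2) ^ 2 : NNReal) = 1 := by
    ext
    simp only [NNReal.coe_pow, NNReal.coe_div, coe_nnnorm]
    norm_num
  rw [this]; simp

lemma spin_mul_self (b : Bool) : spin b * spin b = 1 := by cases b <;> simp [spin]

lemma spin_abs (b : Bool) : |spin b| = 1 := by cases b <;> simp [spin]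

lemma exp_spin (t : ℝ) (b : Bool) : Real.exp (t * spin b) =
    Real.cosh t + Real.sinh t * spin b := by
  rw [Real.cosh_eq, Real.sinh_eq]
  cases b <;> simp [spin] <;> ring

lemma exp_spin_spin (t : ℝ) (b b' : Bool) : Real.exp (t * (spin b * spin b')) =
    Real.cosh t + Real.sinh t * (spin b * spin b') := by
  rw [Real.cosh_eq, Real.sinh_eq]
  cases b <;> cases b' <;> simp [spin] <;> ring

section site
variable {N : ℕ}

lemma sum_conf_prod (g : Fin N → Bool → ℝ) :
    ∑ σ : Fin N → Bool, ∏ i, g i (σ i) = ∏ i, (g i true + g i false) := by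
  have := Finset.prod_univ_sum (fun _ : Fin N => (Finset.univ : Finset Bool)) g
  rw [Fintype.piFinset_univ] at this
  rw [← this]
  simp

/-- product Gibbs measures -/
def siteW (y : Fin N → ℝ) : (Fin N → Bool) → ℝ := fun σ => ∑ i, y i * spin (σ i)

lemma gav_site (y a b : Fin N → ℝ) :
    gav (siteW y) (fun σ => ∏ i, (a i + b i * spin (σ i))) =
      ∏ i, (a i + b i * Real.tanh (y i)) := by
  unfold gav siteW
  simp only [Real.exp_sum, ← Finset.prod_mul_distrib]
  rw [sum_conf_prod (fun i s => (a i + b i * spin s) * Real.exp (y i * spin s)),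
    sum_conf_prod (fun i s => Real.exp (y i * spin s)), ← Finset.prod_div_distrib]
  refine Finset.prod_congr rfl fun i _ => ?_
  rw [Real.tanh_eq_sinh_div_cosh]
  simp only [exp_spin]
  have := (Real.cosh_pos (y i)).ne'
  simp only [spin, if_true, Bool.false_eq_true, if_false]
  have e : Real.cosh (y i) + Real.sinh (y i) * 1 + (Real.cosh (y i) + Real.sinh (y i) * -1) =
    2 * Real.cosh (y i) := by ring
  rw [e]
  field_simp
  ring

lemma gav_site_exp (y : Fin N → ℝ) (t : ℝ) :
    gav (siteW y) (fun σ => Real.exp (t * ∑ i, spin (σ i))) =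
      ∏ i, (Real.cosh t + Real.sinh t * Real.tanh (y i)) := by
  rw [← gav_site y (fun _ => Real.cosh t) (fun _ => Real.sinh t)]
  congr 1; funext σ
  rw [Finset.mul_sum, Real.exp_sum]
  simp only [exp_spin]

lemma gav_site_exp_pair (y : Fin N → ℝ) (t : ℝ) :
    gav (pairW (siteW y)) (fun a => Real.exp (t * ∑ i, spin (a.1 i) * spin (a.2 i))) =
      ∏ i, (Real.cosh t + Real.sinh t * Real.tanh (y i) ^ 2) := by
  rw [gav_pair (siteW y) (fun σ τ => Real.exp (t * ∑ i, spin (σ i) * spin (τ i)))]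
  have : ∀ σ : Fin N → Bool, gav (siteW y) (fun τ => Real.exp (t * ∑ i, spin (σ i) * spin (τ i))) =
      ∏ i, (Real.cosh t + (Real.sinh t * Real.tanh (y i)) * spin (σ i)) := by
    intro σ
    have h := gav_site y (fun _ => Real.cosh t) (fun i => Real.sinh t * spin (σ i))
    rw [show (∏ i, (Real.cosh t + (Real.sinh t * Real.tanh (y i)) * spin (σ i))) =
      ∏ i, (Real.cosh t + (Real.sinh t * spin (σ i)) * Real.tanh (y i)) from
      Finset.prod_congr rfl fun i _ => by ring, ← h]
    congr 1; funext τ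
    rw [Finset.mul_sum, Real.exp_sum]
    refine Finset.prod_congr rfl fun i _ => ?_
    rw [exp_spin_spin]; ring
  simp only [this]
  rw [gav_site y (fun _ => Real.cosh t) (fun i => Real.sinh t * Real.tanh (y i))]
  refine Finset.prod_congr rfl fun i _ => by ring

end site

/-! ### SK features and the exponential moment bound -/

section sk
variable {N : ℕ}

/-- symmetric Gaussian disorder coefficient -/
def wc (i j : Fin N) : ℝ := if i < j then Real.sqrt 2 else if i = j then 1 else 0

lemma wc_sq (i j : Fin N) : wc i j ^ 2 + wc j i ^ 2 = 2 := by
  unfold wc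
  have h2 : Real.sqrt 2 ^ 2 = 2 := Real.sq_sqrt (by norm_num)
  rcases lt_trichotomy i j with h | h | h
  · simp [h, h.not_gt, h.ne', h2]
  · subst h; simp; norm_num
  · simp [h, h.not_gt, h.ne', h2]

lemma wc_sum (a : Fin N → ℝ) : ∑ p : Fin N × Fin N, wc p.1 p.2 ^ 2 * (a p.1 * a p.2) =
    (∑ i, a i) ^ 2 := by
  have h1 : ∑ p : Fin N × Fin N, wc p.1 p.2 ^ 2 * (a p.1 * a p.2) =
      ∑ p : Fin N × Fin N, wc p.2 p.1 ^ 2 * (a p.1 * a p.2) := by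
    refine Fintype.sum_equiv (Equiv.prodComm _ _) _ _ fun p => ?_
    simp only [Equiv.prodComm_apply, Prod.fst_swap, Prod.snd_swap]
    ring
  have h2 : ∑ p : Fin N × Fin N, wc p.1 p.2 ^ 2 * (a p.1 * a p.2) +
      ∑ p : Fin N × Fin N, wc p.2 p.1 ^ 2 * (a p.1 * a p.2) = 2 * (∑ i, a i) ^ 2 := by
    rw [← Finset.sum_add_distrib, sq, Finset.sum_mul_sum, Fintype.sum_prod_type, Finset.mul_sum]
    refine Finset.sum_congr rfl fun i _ => ?_
    rw [Finset.mul_sum]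
    refine Finset.sum_congr rfl fun j _ => ?_
    rw [← add_mul, wc_sq]
  linarith

/-- features of the SK Hamiltonian -/
def skφ (N : ℕ) (β q : ℝ) : (Fin N × Fin N) ⊕ Fin N → (Fin N → Bool) → ℝ :=
  Sum.elim (fun p σ => β / Real.sqrt (2 * N) * wc p.1 p.2 * (spin (σ p.1) * spin (σ p.2)))
    (fun i σ => β * Real.sqrt q * spin (σ i))

def magS (σ : Fin N → Bool) : ℝ := ∑ i, spin (σ i)

lemma skφ_cov (hN : 0 < N) (β q : ℝ) (hq : 0 ≤ q) (σ τ : Fin N → Bool) :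
    ∑ k, skφ N β q (Sum.inl k) σ * skφ N β q (Sum.inl k) τ -
      ∑ k, skφ N β q (Sum.inr k) σ * skφ N β q (Sum.inr k) τ =
      β ^ 2 * N / 2 * ((overlap σ τ - q) ^ 2 - q ^ 2) := by
  have hN' : (0 : ℝ) < N := by exact_mod_cast hN
  have hs : Real.sqrt (2 * N) ^ 2 = 2 * N := Real.sq_sqrt (by positivity)
  have hs0 : Real.sqrt (2 * N) ≠ 0 := by positivity
  have hq2 : Real.sqrt q ^ 2 = q := Real.sq_sqrt hq
  have h1 : ∑ k, skφ N β q (Sum.inl k) σ * skφ N β q (Sum.inl k) τ =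
      β ^ 2 / (2 * N) * (∑ i, spin (σ i) * spin (τ i)) ^ 2 := by
    rw [← wc_sum, Finset.mul_sum]
    refine Finset.sum_congr rfl fun p _ => ?_
    simp only [skφ, Sum.elim_inl]
    have e : β ^ 2 / (2 * (N:ℝ)) = (β / Real.sqrt (2 * N)) ^ 2 := by rw [div_pow, hs]
    rw [e]
    ring
  have h2 : ∑ k, skφ N β q (Sum.inr k) σ * skφ N β q (Sum.inr k) τ =
      β ^ 2 * q * ∑ i, spin (σ i) * spin (τ i) := by
    rw [Finset.mul_sum]
    refine Finset.sum_congr rfl fun p _ => ?_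
    simp only [skφ, Sum.elim_inr]
    linear_combination (β ^ 2 * spin (σ p) * spin (τ p)) * hq2
  rw [h1, h2, overlap]
  field_simp
  ring

lemma overlap_self (hN : 0 < N) (σ : Fin N → Bool) : overlap σ σ = 1 := by
  have hN' : (N : ℝ) ≠ 0 := by exact_mod_cast hN.ne'
  simp [overlap, spin_mul_self, hN']

lemma overlap_comm (σ τ : Fin N → Bool) : overlap σ τ = overlap τ σ := by
  simp only [overlap, mul_comm]

lemma integral_prod_inr {κ : Type*} [Fintype κ] (F : ℝ → ℝ) :
    ∫ x : κ ⊕ Fin N → ℝ, ∏ i, F (x (Sum.inr i)) ∂gamPi (κ ⊕ Fin N) = (∫ g, F g ∂gam) ^ N := by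
  have := integral_fintype_prod_eq_prod (μ := fun _ : κ ⊕ Fin N => gam)
    (fun k : κ ⊕ Fin N => Sum.elim (fun _ => fun _ : ℝ => (1 : ℝ)) (fun _ => F) k)
  simp only [Fintype.prod_sum_type, Sum.elim_inl, Sum.elim_inr, Finset.prod_const_one, one_mul,
    integral_const, probReal_univ, smul_eq_mul, Finset.prod_const, Finset.card_univ,
    Fintype.card_fin] at this
  exact this

/-- normalized weight -/
def nwt {A : Type*} [Fintype A] (u : A → ℝ) (a : A) : ℝ := Real.exp (u a) / ∑ a, Real.exp (u a)

lemma gav_eq_nwt {A : Type*} [Fintype A] (u g : A → ℝ) : gav u g = ∑ a, g a * nwt u a := by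
  simp only [gav, nwt, Finset.sum_div, mul_div_assoc]

lemma nwt_nonneg {A : Type*} [Fintype A] (u : A → ℝ) (a : A) : 0 ≤ nwt u a := by
  unfold nwt; positivity

lemma nwt_le_one {A : Type*} [Fintype A] [Nonempty A] (u : A → ℝ) (a : A) : nwt u a ≤ 1 := by
  unfold nwt
  rw [div_le_one (sumexp_pos u)]
  exact Finset.single_le_sum (f := fun a => Real.exp (u a)) (fun a _ => (Real.exp_pos _).le)
    (Finset.mem_univ a)

lemma integral_gav {A X : Type*} [Fintype A] [Nonempty A] [TopologicalSpace X] [MeasurableSpace X]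
    [OpensMeasurableSpace X] [SecondCountableTopology X]
    (μ : Measure X) [IsFiniteMeasure μ] (u : X → A → ℝ)
    (hu : ∀ a, Continuous fun x => u x a) (g : A → ℝ) :
    ∫ x, gav (u x) g ∂μ = ∑ a, g a * ∫ x, nwt (u x) a ∂μ := by
  simp only [gav_eq_nwt]
  have hi : ∀ a, Integrable (fun x => nwt (u x) a) μ := fun a => by
    refine Integrable.of_bound (C := 1) ?_ (Filter.Eventually.of_forall fun x => ?_)
    · refine Continuous.aestronglyMeasurable ?_
      unfold nwt
      refine Continuous.div ?_ ?_ (fun x => (sumexp_pos _).ne') <;> fun_prop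
    · rw [Real.norm_eq_abs, abs_of_nonneg (nwt_nonneg _ _)]
      exact nwt_le_one _ _
  rw [integral_finsetSum _ fun a _ => (hi a).const_mul (g a)]
  simp only [integral_const_mul]

lemma exp_add_le_young (A B α : ℝ) (h0 : 0 < α) (h1 : α < 1) :
    Real.exp (A + B) ≤ Real.exp (A / α) + Real.exp (B / (1 - α)) := by
  have hA := Real.exp_pos (A / α)
  have hB := Real.exp_pos (B / (1 - α))
  have h3 : 0 < 1 - α := by linarith
  rcases le_total (A / α) (B / (1 - α)) with h | h
  · have : A + B ≤ B / (1 - α) := by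
      have e1 : A = α * (A / α) := by field_simp
      have e2 : B = (1 - α) * (B / (1 - α)) := by field_simp
      have := mul_le_mul_of_nonneg_left h h0.le
      linarith
    have := Real.exp_le_exp.2 this
    linarith
  · have : A + B ≤ A / α := by
      have e1 : A = α * (A / α) := by field_simp
      have e2 : B = (1 - α) * (B / (1 - α)) := by field_simp
      have := mul_le_mul_of_nonneg_left h h3.le
      linarith
    have := Real.exp_le_exp.2 this
    linarith

/-- explicit constants -/
def k0 (β : ℝ) : ℝ := (1 + β ^ 2) / 2
def k2 (β : ℝ) : ℝ := (1 + k0 β) / 2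
def kα (β : ℝ) : ℝ := k0 β / k2 β
def klam (β : ℝ) : ℝ := (1 - kα β) / 2
def k1 (β : ℝ) : ℝ := k0 β - β ^ 2
def kp (β : ℝ) : ℝ := Real.exp (-(3 * β ^ 2 / (k0 β - β ^ 2)))
def kC (β : ℝ) : ℝ := ∫ ξ, Real.exp (k2 β * ξ ^ 2 / 2) ∂gam + ∫ ξ, Real.exp (1 / 2 * ξ ^ 2 / 2) ∂gam

/-- the two-replica tilt -/
def skF (N : ℕ) (β s q m : ℝ) : (Fin N → Bool) × (Fin N → Bool) → ℝ := fun a =>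
  s * ((N : ℝ) / 2 * (overlap a.1 a.2 - q) ^ 2) + klam β * ((N : ℝ) / 2 * (magS a.1 / N - m) ^ 2)

lemma iV_zero (β q h : ℝ) (x : (Fin N × Fin N) ⊕ Fin N → ℝ) :
    iV (skφ N β q) (fun σ => h * magS σ) (cI 0) x =
      siteW (fun i => β * x (Sum.inr i) * Real.sqrt q + h) := by
  funext σ
  simp only [iV, Fintype.sum_sum_type, cI, Sum.elim_inl, Sum.elim_inr, Real.sin_zero, Real.cos_zero,
    skφ, siteW, magS, zero_mul, Finset.sum_const_zero, zero_add, add_mul, Finset.sum_add_distrib,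
    Finset.mul_sum]
  congr 1
  refine Finset.sum_congr rfl fun i _ => by ring

lemma tanh_int_bound (c d : ℝ) : |∫ g, Real.tanh (c * g + d) ∂gam| ≤ 1 := by
  have := norm_integral_le_of_norm_le_const (μ := gam) (f := fun g => Real.tanh (c * g + d)) (C := 1)
    (Filter.Eventually.of_forall fun g => (Real.abs_tanh_lt_one _).le)
  simpa using this

lemma theta_zero_bound (hN : 0 < N) (β h q m : ℝ) (hβ0 : 0 < β) (hβ1 : β < 1)
    (hq0 : 0 ≤ q) (hq1 : q ≤ 1)
    (hq : q = ∫ g, Real.tanh (β * g * Real.sqrt q + h) ^ 2 ∂gam)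
    (hm : m = ∫ g, Real.tanh (β * g * Real.sqrt q + h) ∂gam) :
    ∫ x, Real.exp (iL (fun k => pairSum (skφ N β q k)) (pairSum (fun σ => h * magS σ))
        (skF N β (k0 β) q m) (cI 0) x) ∂gamPi ((Fin N × Fin N) ⊕ Fin N) ≤ kC β := by
  have hN' : (0 : ℝ) < N := by exact_mod_cast hN
  have hβ2 : β ^ 2 < 1 := by nlinarith
  have h00 : 0 < k0 β := by unfold k0; positivity
  have h01 : k0 β < 1 := by unfold k0; linarith
  have h20 : 0 < k2 β := by unfold k2; positivity
  have h21 : k2 β < 1 := by unfold k2; linarith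
  have h02 : k0 β < k2 β := by unfold k2; linarith
  have hα0 : 0 < kα β := div_pos h00 h20
  have hα1 : kα β < 1 := (div_lt_one h20).2 h02
  have hm1 : |m| ≤ 1 := by
    rw [hm]
    have := tanh_int_bound (β * Real.sqrt q) h
    convert this using 5
    ring
  set u : ((Fin N × Fin N) ⊕ Fin N → ℝ) → (Fin N → Bool) × (Fin N → Bool) → ℝ := fun x =>
    pairW (siteW (fun i => β * x (Sum.inr i) * Real.sqrt q + h)) with hu
  have huc : ∀ a, Continuous fun x => u x a := by
    intro a
    simp only [hu, pairW, siteW]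
    fun_prop
  set P : (Fin N → Bool) × (Fin N → Bool) → ℝ := fun a =>
    ∫ x, nwt (u x) a ∂gamPi ((Fin N × Fin N) ⊕ Fin N) with hP
  have hP0 : ∀ a, 0 ≤ P a := fun a => integral_nonneg fun x => nwt_nonneg _ _
  have e1 : ∀ x, Real.exp (iL (fun k => pairSum (skφ N β q k)) (pairSum (fun σ => h * magS σ))
        (skF N β (k0 β) q m) (cI 0) x) = gav (u x) (fun a => Real.exp (skF N β (k0 β) q m a)) := by
    intro x
    rw [gav_exp, iL, iV_pair, iV_zero]
  simp only [e1]
  rw [integral_gav _ u huc]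
  set S1 : (Fin N → Bool) × (Fin N → Bool) → ℝ := fun a =>
    ∑ i, spin (a.1 i) * spin (a.2 i) - N * q with hS1
  set S2 : (Fin N → Bool) × (Fin N → Bool) → ℝ := fun a => magS a.1 - N * m with hS2
  have hb1 : ∑ a, Real.exp (k2 β * S1 a ^ 2 / (2 * N)) * P a ≤
      ∫ ξ, Real.exp (k2 β * ξ ^ 2 / 2) ∂gam := by
    apply hs_bound P S1 N (k2 β) hN' h20.le h21
    intro t
    rw [← integral_gav _ u huc]
    have e2 : ∀ x, gav (u x) (fun a => Real.exp (t * S1 a)) = Real.exp (-(t * (N * q))) *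
        ∏ i, (Real.cosh t + Real.sinh t * Real.tanh (β * x (Sum.inr i) * Real.sqrt q + h) ^ 2) := by
      intro x
      rw [← gav_site_exp_pair, ← gav_const_mul]
      congr 1; funext a
      rw [← Real.exp_add]
      congr 1; simp only [hS1]; ring
    simp only [e2]
    rw [integral_const_mul, integral_prod_inr
      (fun g => Real.cosh t + Real.sinh t * Real.tanh (β * g * Real.sqrt q + h) ^ 2)]
    have e3 : ∫ g, (Real.cosh t + Real.sinh t * Real.tanh (β * g * Real.sqrt q + h) ^ 2) ∂gam =
        Real.cosh t + Real.sinh t * q := by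
      rw [integral_add (integrable_const _), integral_const_mul, ← hq]
      · simp
      · refine Integrable.const_mul ?_ _
        refine Integrable.of_bound (C := 1) (Continuous.aestronglyMeasurable ?_)
          (Filter.Eventually.of_forall fun g => ?_)
        · have := tanh_continuous
          fun_prop
        · rw [Real.norm_eq_abs, abs_pow]
          exact pow_le_one₀ (abs_nonneg _) (Real.abs_tanh_lt_one _).le
    rw [e3]
    have e4 := two_point q t (by linarith) hq1
    have e5 : 0 ≤ Real.cosh t + Real.sinh t * q := by
      rw [← e3]
      refine integral_nonneg fun g => ?_
      have h1 := (Real.tanh_sq_lt_one (β * g * Real.sqrt q + h)).le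
      have h2 := sq_nonneg (Real.tanh (β * g * Real.sqrt q + h))
      rw [Real.cosh_eq, Real.sinh_eq]
      have h3 := Real.exp_pos t
      have h4 := Real.exp_pos (-t)
      show (0 : ℝ) ≤ _
      nlinarith [mul_nonneg h3.le h2, mul_nonneg h4.le (sub_nonneg.2 h1)]
    calc Real.exp (-(t * (N * q))) * (Real.cosh t + Real.sinh t * q) ^ N
        ≤ Real.exp (-(t * (N * q))) * (Real.exp (t * q + t ^ 2 / 2)) ^ N := by gcongr
      _ = Real.exp (N * t ^ 2 / 2) := by
        rw [← Real.exp_nat_mul, ← Real.exp_add]; congr 1; ring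
  have hb2 : ∑ a, Real.exp (1 / 2 * S2 a ^ 2 / (2 * N)) * P a ≤
      ∫ ξ, Real.exp (1 / 2 * ξ ^ 2 / 2) ∂gam := by
    apply hs_bound P S2 N (1 / 2) hN' (by norm_num) (by norm_num)
    intro t
    rw [← integral_gav _ u huc]
    have e2 : ∀ x, gav (u x) (fun a => Real.exp (t * S2 a)) = Real.exp (-(t * (N * m))) *
        ∏ i, (Real.cosh t + Real.sinh t * Real.tanh (β * x (Sum.inr i) * Real.sqrt q + h)) := by
      intro x
      rw [← gav_site_exp, ← gav_pair_fst (siteW (fun i => β * x (Sum.inr i) * Real.sqrt q + h)) (fun σ => Real.exp (t * ∑ i, spin (σ i))), ← gav_const_mul]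
      congr 1; funext a
      rw [← Real.exp_add]
      congr 1; simp only [hS2, magS]; ring
    simp only [e2]
    rw [integral_const_mul, integral_prod_inr
      (fun g => Real.cosh t + Real.sinh t * Real.tanh (β * g * Real.sqrt q + h))]
    have e3 : ∫ g, (Real.cosh t + Real.sinh t * Real.tanh (β * g * Real.sqrt q + h)) ∂gam =
        Real.cosh t + Real.sinh t * m := by
      rw [integral_add (integrable_const _), integral_const_mul, ← hm]
      · simp
      · refine Integrable.const_mul ?_ _
        refine Integrable.of_bound (C := 1) (Continuous.aestronglyMeasurable ?_)
          (Filter.Eventually.of_forall fun g => ?_)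
        · have := tanh_continuous
          fun_prop
        · rw [Real.norm_eq_abs]
          exact (Real.abs_tanh_lt_one _).le
    rw [e3]
    have e4 := two_point m t (abs_le.1 hm1).1 (abs_le.1 hm1).2
    have e5 : 0 ≤ Real.cosh t + Real.sinh t * m := by
      have h1 := (abs_le.1 hm1).1
      have h2 := (abs_le.1 hm1).2
      rw [Real.cosh_eq, Real.sinh_eq]
      have h3 := Real.exp_pos t
      have h4 := Real.exp_pos (-t)
      nlinarith [mul_nonneg h3.le (by linarith : 0 ≤ 1 + m), mul_nonneg h4.le (sub_nonneg.2 h2)]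
    calc Real.exp (-(t * (N * m))) * (Real.cosh t + Real.sinh t * m) ^ N
        ≤ Real.exp (-(t * (N * m))) * (Real.exp (t * m + t ^ 2 / 2)) ^ N := by gcongr
      _ = Real.exp (N * t ^ 2 / 2) := by
        rw [← Real.exp_nat_mul, ← Real.exp_add]; congr 1; ring
  refine le_trans ?_ (add_le_add hb1 hb2)
  rw [← Finset.sum_add_distrib]
  refine Finset.sum_le_sum fun a _ => ?_
  rw [← add_mul]
  refine mul_le_mul_of_nonneg_right ?_ (hP0 a)
  have := exp_add_le_young (k0 β * ((N : ℝ) / 2 * (overlap a.1 a.2 - q) ^ 2))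
    (klam β * ((N : ℝ) / 2 * (magS a.1 / N - m) ^ 2)) (kα β) hα0 hα1
  refine this.trans (le_of_eq ?_)
  have hα1' : (1 - kα β) ≠ 0 := by linarith
  congr 2
  · simp only [hS1, overlap, kα]
    field_simp
  · simp only [hS2, klam]
    field_simp

/-- exponential moment for the SK model at parameters `β, h` -/
theorem sk_moment (hN : 0 < N) (β h q m : ℝ) (hβ0 : 0 < β) (hβ1 : β < 1)
    (hq0 : 0 ≤ q) (hq1 : q ≤ 1)
    (hq : q = ∫ g, Real.tanh (β * g * Real.sqrt q + h) ^ 2 ∂gam)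
    (hm : m = ∫ g, Real.tanh (β * g * Real.sqrt q + h) ∂gam) :
    ∫ x, Real.exp (kp β * iL (fun k => pairSum (skφ N β q k)) (pairSum (fun σ => h * magS σ))
        (skF N β (k1 β) q m) (cI (Real.pi / 2)) x) ∂gamPi ((Fin N × Fin N) ⊕ Fin N) ≤ kC β := by
  have hβ2 : β ^ 2 < 1 := by nlinarith
  have h01 : k0 β < 1 := by unfold k0; linarith
  have h20 : 0 < k2 β := by unfold k2 k0; positivity
  have h02 : k0 β < k2 β := by unfold k2; linarith
  have hα1 : kα β < 1 := (div_lt_one h20).2 h02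
  have hlam : 0 < klam β := by unfold klam; linarith
  refine le_trans ?_ (theta_zero_bound hN β h q m hβ0 hβ1 hq0 hq1 hq hm)
  exact main_interp (skφ N β q) (fun σ τ => (overlap σ τ - q) ^ 2) N β q ((1 - q) ^ 2) (k0 β)
    (Nat.cast_nonneg N) (fun _ _ => sq_nonneg _) (fun σ => by rw [overlap_self hN])
    (fun σ τ => by rw [overlap_comm]) (by unfold k0; linarith) (skφ_cov hN β q hq0)
    (fun σ => h * magS σ) _ (fun a => by positivity)

end sk

/-! ### The overlap constant and `q1` -/

section qfacts

lemma gauss_taylor {F F1 F2 : ℝ → ℝ} {M B : ℝ} (h1 : ∀ x, HasDerivAt F (F1 x) x)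
    (h2 : ∀ x, HasDerivAt F1 (F2 x) x) (hM : ∀ x, |F2 x| ≤ M) (hB : ∀ x, |F x| ≤ B)
    (x : ℝ) (w : NNReal) : M / 2 * x ^ 2 + F x ≤ M / 2 * (x ^ 2 + w) +
      ∫ y, F (x + y) ∂gaussianReal 0 w := by
  have hFc : Continuous F := continuous_iff_continuousAt.2 fun x => (h1 x).continuousAt
  have hconv : ConvexOn ℝ Set.univ (fun x => M / 2 * x ^ 2 + F x) := by
    refine convexOn_of_hasDerivWithinAt2_nonneg (f' := fun x => M * x + F1 x)
      (f'' := fun x => M + F2 x) convex_univ (by fun_prop) ?_ ?_ ?_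
    · intro x _
      refine HasDerivAt.hasDerivWithinAt ?_
      refine (((hasDerivAt_pow 2 x).const_mul (M / 2)).add (h1 x)).congr_deriv ?_
      simp; ring
    · intro x _
      refine HasDerivAt.hasDerivWithinAt ?_
      refine (((hasDerivAt_id x).const_mul M).add (h2 x)).congr_deriv ?_
      simp
    · intro x _
      have := (abs_le.1 (hM x)).1
      linarith
  have hid : Integrable (fun y : ℝ => y) (gaussianReal 0 w) := by
    have := (memLp_id_gaussianReal (μ := 0) (v := w) 1)
    exact this.integrable le_rfl
  have hid2 : Integrable (fun y : ℝ => y ^ 2) (gaussianReal 0 w) := by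
    have := (memLp_id_gaussianReal (μ := 0) (v := w) 2)
    exact MemLp.integrable_sq this
  have hFi : Integrable (fun y => F (x + y)) (gaussianReal 0 w) :=
    Integrable.of_bound (C := B) (Continuous.aestronglyMeasurable (by fun_prop))
      (Filter.Eventually.of_forall fun y => hB _)
  have hi1 : ∫ y : ℝ, y ∂gaussianReal 0 w = 0 := by
    simpa using integral_id_gaussianReal (μ := 0) (v := w)
  have hi2 : ∫ y : ℝ, y ^ 2 ∂gaussianReal 0 w = w := by
    have h := variance_id_gaussianReal (μ := 0) (v := w)
    rw [variance_eq_integral (by fun_prop)] at h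
    simpa using h
  have hq : Integrable (fun y : ℝ => M / 2 * (x + y) ^ 2) (gaussianReal 0 w) := by
    have : (fun y : ℝ => M / 2 * (x + y) ^ 2) =
        fun y => M / 2 * x ^ 2 + (M * x * y + M / 2 * y ^ 2) := by funext y; ring
    rw [this]
    exact (integrable_const _).add ((hid.const_mul _).add (hid2.const_mul _))
  have hq2 : ∫ y, M / 2 * (x + y) ^ 2 ∂gaussianReal 0 w = M / 2 * (x ^ 2 + w) := by
    have : (fun y : ℝ => M / 2 * (x + y) ^ 2) =
        fun y => M / 2 * x ^ 2 + (M * x * y + M / 2 * y ^ 2) := by funext y; ring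
    have hadd : Integrable (fun y : ℝ => M * x * y + M / 2 * y ^ 2) (gaussianReal 0 w) :=
      (hid.const_mul _).add (hid2.const_mul _)
    rw [this, integral_add (integrable_const _) hadd,
      integral_add (hid.const_mul _) (hid2.const_mul _), integral_const_mul, integral_const_mul,
      integral_const_mul, hi1, hi2]
    simp; ring
  have := hconv.map_integral_le (μ := gaussianReal 0 w) (f := fun y => x + y) (by fun_prop)
    isClosed_univ (by simp) ((integrable_const _).add hid) (by
      exact hq.add hFi)
  rw [integral_add (integrable_const _) hid, hi1, integral_add hq hFi, hq2] at this
  simpa using this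

lemma gauss_smooth {F F1 F2 : ℝ → ℝ} {M B : ℝ} (h1 : ∀ x, HasDerivAt F (F1 x) x)
    (h2 : ∀ x, HasDerivAt F1 (F2 x) x) (hM : ∀ x, |F2 x| ≤ M) (hB : ∀ x, |F x| ≤ B)
    (v w : NNReal) :
    |∫ y, F y ∂gaussianReal 0 (v + w) - ∫ y, F y ∂gaussianReal 0 v| ≤ M / 2 * w := by
  have hFc : Continuous F := continuous_iff_continuousAt.2 fun x => (h1 x).continuousAt
  have hFi : ∀ μ : Measure ℝ, IsProbabilityMeasure μ → Integrable F μ := fun μ _ =>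
    Integrable.of_bound (C := B) hFc.aestronglyMeasurable (Filter.Eventually.of_forall hB)
  have e : gaussianReal 0 (v + w) = gaussianReal 0 v ∗ gaussianReal 0 w := by
    rw [gaussianReal_conv_gaussianReal]; simp
  have hp : ∀ x, |∫ y, F (x + y) ∂gaussianReal 0 w - F x| ≤ M / 2 * w := by
    intro x
    have a := gauss_taylor h1 h2 hM hB x w
    have b := gauss_taylor (F := fun x => -F x) (F1 := fun x => -F1 x) (F2 := fun x => -F2 x)
      (M := M) (B := B) (fun x => (h1 x).neg)
      (fun x => (h2 x).neg) (fun x => by rw [abs_neg]; exact hM x)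
      (fun x => by rw [abs_neg]; exact hB x) x w
    rw [integral_neg] at b
    rw [abs_le]; constructor <;> linarith
  rw [e, integral_conv (by rw [← e]; exact hFi _ inferInstance),
    ← integral_sub _ (hFi _ inferInstance)]
  · have := norm_integral_le_of_norm_le_const (μ := gaussianReal 0 v)
      (f := fun x => ∫ y, F (x + y) ∂gaussianReal 0 w - F x) (C := M / 2 * w) (Filter.Eventually.of_forall hp)
    simpa using this
  · refine Integrable.of_bound (C := B) ?_ (Filter.Eventually.of_forall fun x => ?_)
    · refine StronglyMeasurable.aestronglyMeasurable ?_
      refine StronglyMeasurable.integral_prod_right (f := fun x y : ℝ => F (x + y)) ?_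
      exact Continuous.stronglyMeasurable (by fun_prop)
    · have := norm_integral_le_of_norm_le_const (μ := gaussianReal 0 w) (C := B)
        (f := fun y => F (x + y)) (Filter.Eventually.of_forall fun y => hB _)
      simpa using this

/-- `q ↦ E F(β g √q + h)` is Lipschitz. -/
lemma gauss_lip {F F1 F2 : ℝ → ℝ} {M B : ℝ} (h1 : ∀ x, HasDerivAt F (F1 x) x)
    (h2 : ∀ x, HasDerivAt F1 (F2 x) x) (hM : ∀ x, |F2 x| ≤ M) (hB : ∀ x, |F x| ≤ B)
    (β h q q' : ℝ) (hq : 0 ≤ q) (hq' : 0 ≤ q') :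
    |∫ g, F (β * g * Real.sqrt q + h) ∂gam - ∫ g, F (β * g * Real.sqrt q' + h) ∂gam| ≤
      M / 2 * β ^ 2 * |q - q'| := by
  have hFc : Continuous F := continuous_iff_continuousAt.2 fun x => (h1 x).continuousAt
  have key : ∀ q : ℝ, 0 ≤ q → ∫ g, F (β * g * Real.sqrt q + h) ∂gam =
      ∫ y, F (y + h) ∂gaussianReal 0 (β ^ 2 * q).toNNReal := by
    intro q hq
    have e : gaussianReal 0 (β ^ 2 * q).toNNReal = gam.map (fun x => (β * Real.sqrt q) * x) := by
      rw [gaussianReal_map_const_mul]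
      simp only [mul_zero, mul_one]
      congr 1
      apply NNReal.eq
      rw [Real.coe_toNNReal _ (by positivity)]
      show _ = (β * Real.sqrt q) ^ 2
      rw [mul_pow, Real.sq_sqrt hq]
    rw [e, integral_map (by fun_prop) (Continuous.aestronglyMeasurable (by fun_prop))]
    refine integral_congr_ae (Filter.Eventually.of_forall fun g => ?_)
    show F _ = F _
    congr 1; ring
  wlog hle : q' ≤ q generalizing q q'
  · rw [abs_sub_comm, abs_sub_comm q q']
    exact this q' q hq' hq (not_le.1 hle).le
  rw [key q hq, key q' hq']
  have hs : (β ^ 2 * q).toNNReal = (β ^ 2 * q').toNNReal + (β ^ 2 * (q - q')).toNNReal := by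
    have : 0 ≤ q - q' := by linarith
    rw [← Real.toNNReal_add (by positivity) (by positivity)]
    congr 1; ring
  rw [hs]
  have := gauss_smooth (F := fun x => F (x + h)) (F1 := fun x => F1 (x + h))
    (F2 := fun x => F2 (x + h)) (M := M) (B := B) (fun x => (h1 (x + h)).comp_add_const x h)
    (fun x => (h2 (x + h)).comp_add_const x h) (fun x => hM _) (fun x => hB _)
    (β ^ 2 * q').toNNReal (β ^ 2 * (q - q')).toNNReal
  refine this.trans (le_of_eq ?_)
  have h3 : 0 ≤ q - q' := by linarith
  rw [Real.coe_toNNReal _ (by positivity), abs_of_nonneg h3]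
  ring

lemma tanh_hasDerivAt2 (x : ℝ) : HasDerivAt (fun x => 1 - Real.tanh x ^ 2)
    (-(2 * Real.tanh x * (1 - Real.tanh x ^ 2))) x := by
  refine (((tanh_hasDerivAt x).pow 2).const_sub 1).congr_deriv ?_
  simp

lemma tanhsq_hasDerivAt (x : ℝ) : HasDerivAt (fun x => Real.tanh x ^ 2)
    (2 * Real.tanh x * (1 - Real.tanh x ^ 2)) x := by
  refine ((tanh_hasDerivAt x).pow 2).congr_deriv ?_
  simp

lemma tanhsq_hasDerivAt2 (x : ℝ) : HasDerivAt (fun x => 2 * Real.tanh x * (1 - Real.tanh x ^ 2))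
    (2 * (1 - Real.tanh x ^ 2) * (1 - 3 * Real.tanh x ^ 2)) x := by
  refine (((tanh_hasDerivAt x).const_mul 2).mul (tanh_hasDerivAt2 x)).congr_deriv ?_
  ring

/-- the overlap map -/
def qPhi (β h q : ℝ) : ℝ := ∫ g, Real.tanh (β * g * Real.sqrt q + h) ^ 2 ∂gam
def mPhi (β h q : ℝ) : ℝ := ∫ g, Real.tanh (β * g * Real.sqrt q + h) ∂gam

lemma tanh_sq_abs_le (x : ℝ) : |Real.tanh x ^ 2| ≤ 1 := by
  rw [abs_of_nonneg (sq_nonneg _)]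
  exact (Real.tanh_sq_lt_one _).le

lemma qPhi_lip (β h q q' : ℝ) (hq : 0 ≤ q) (hq' : 0 ≤ q') :
    |qPhi β h q - qPhi β h q'| ≤ β ^ 2 * |q - q'| := by
  have := gauss_lip (M := 2) (B := 1) tanhsq_hasDerivAt tanhsq_hasDerivAt2 (fun x => by
    have h1 := (Real.tanh_sq_lt_one x).le
    have h2 := sq_nonneg (Real.tanh x)
    rw [abs_le]; constructor <;> nlinarith) tanh_sq_abs_le β h q q' hq hq'
  unfold qPhi
  linarith

lemma mPhi_lip (β h q q' : ℝ) (hq : 0 ≤ q) (hq' : 0 ≤ q') :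
    |mPhi β h q - mPhi β h q'| ≤ β ^ 2 * |q - q'| := by
  have := gauss_lip (M := 2) (B := 1) tanh_hasDerivAt tanh_hasDerivAt2 (fun x => by
    have h1 := (Real.tanh_sq_lt_one x).le
    have h2 := sq_nonneg (Real.tanh x)
    have h3 := abs_le.1 (Real.abs_tanh_lt_one x).le
    rw [abs_le]; constructor <;> nlinarith) (fun x => (Real.abs_tanh_lt_one x).le) β h q q' hq hq'
  unfold mPhi
  linarith

lemma tanh_lip (x y : ℝ) : |Real.tanh x - Real.tanh y| ≤ |x - y| := by
  have := Convex.norm_image_sub_le_of_norm_hasDerivWithin_le (f := Real.tanh) (C := 1)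
    (fun x _ => (tanh_hasDerivAt x).hasDerivWithinAt) (fun x _ => by
      have h1 := (Real.tanh_sq_lt_one x).le
      have h2 := sq_nonneg (Real.tanh x)
      rw [Real.norm_eq_abs, abs_le]; constructor <;> linarith) convex_univ (Set.mem_univ y)
      (Set.mem_univ x)
  simpa using this

lemma integrable_tanh (β h q : ℝ) : Integrable (fun g => Real.tanh (β * g * Real.sqrt q + h)) gam := by
  have := tanh_continuous
  exact Integrable.of_bound (C := 1) (Continuous.aestronglyMeasurable (by fun_prop))
    (Filter.Eventually.of_forall fun y => (Real.abs_tanh_lt_one _).le)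

lemma integrable_tanh_sq (β h q : ℝ) :
    Integrable (fun g => Real.tanh (β * g * Real.sqrt q + h) ^ 2) gam := by
  have := tanh_continuous
  exact Integrable.of_bound (C := 1) (Continuous.aestronglyMeasurable (by fun_prop))
    (Filter.Eventually.of_forall fun y => tanh_sq_abs_le _)

lemma qPhi_lip_h (β h h' q : ℝ) : |qPhi β h q - qPhi β h' q| ≤ 2 * |h - h'| := by
  unfold qPhi
  rw [← integral_sub (integrable_tanh_sq _ _ _) (integrable_tanh_sq _ _ _)]
  have := norm_integral_le_of_norm_le_const (μ := gam) (C := 2 * |h - h'|)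
    (f := fun g => Real.tanh (β * g * Real.sqrt q + h) ^ 2 - Real.tanh (β * g * Real.sqrt q + h') ^ 2)
    (Filter.Eventually.of_forall fun g => by
      have h1 := tanh_lip (β * g * Real.sqrt q + h) (β * g * Real.sqrt q + h')
      rw [add_sub_add_left_eq_sub] at h1
      have h2 := (Real.abs_tanh_lt_one (β * g * Real.sqrt q + h)).le
      have h3 := (Real.abs_tanh_lt_one (β * g * Real.sqrt q + h')).le
      rw [Real.norm_eq_abs, sq_sub_sq, abs_mul]
      refine mul_le_mul ?_ h1 (abs_nonneg _) (by norm_num)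
      refine (abs_add_le _ _).trans (by linarith))
  simpa using this

lemma mPhi_lip_h (β h h' q : ℝ) : |mPhi β h q - mPhi β h' q| ≤ |h - h'| := by
  unfold mPhi
  rw [← integral_sub (integrable_tanh _ _ _) (integrable_tanh _ _ _)]
  have := norm_integral_le_of_norm_le_const (μ := gam) (C := |h - h'|)
    (f := fun g => Real.tanh (β * g * Real.sqrt q + h) - Real.tanh (β * g * Real.sqrt q + h'))
    (Filter.Eventually.of_forall fun g => by
      have h1 := tanh_lip (β * g * Real.sqrt q + h) (β * g * Real.sqrt q + h')
      rwa [add_sub_add_left_eq_sub] at h1)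
  simpa using this

lemma qPhi_zero (β h : ℝ) : qPhi β h 0 = Real.tanh h ^ 2 := by simp [qPhi]
lemma mPhi_zero (β h : ℝ) : mPhi β h 0 = Real.tanh h := by simp [mPhi]

lemma qPhi_mem (β h q : ℝ) : qPhi β h q ∈ Set.Icc (0 : ℝ) 1 := by
  constructor
  · exact integral_nonneg fun _ => sq_nonneg _
  · have := norm_integral_le_of_norm_le_const (μ := gam) (C := 1)
      (f := fun g => Real.tanh (β * g * Real.sqrt q + h) ^ 2)
      (Filter.Eventually.of_forall fun g => tanh_sq_abs_le _)
    simp at this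
    exact (le_abs_self _).trans this

lemma qOverlap_spec (β h : ℝ) (hβ0 : 0 < β) (hβ1 : β < 1) :
    0 ≤ qOverlap β h ∧ qOverlap β h ≤ 1 ∧ qOverlap β h = qPhi β h (qOverlap β h) := by
  have hβ2 : β ^ 2 < 1 := by nlinarith
  by_cases h0 : h = 0
  · simp [qOverlap, h0, qPhi_zero]
  have hc : ContinuousOn (qPhi β h) (Set.Icc 0 1) := by
    have : LipschitzOnWith 1 (qPhi β h) (Set.Icc 0 1) := by
      refine LipschitzOnWith.of_dist_le_mul fun x hx y hy => ?_
      rw [Real.dist_eq, Real.dist_eq]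
      refine (qPhi_lip β h x y hx.1 hy.1).trans ?_
      have := abs_nonneg (x - y)
      simp; nlinarith
    exact this.continuousOn
  obtain ⟨c, hc, hfix⟩ := exists_mem_Icc_isFixedPt_of_mapsTo hc zero_le_one
    (fun x _ => qPhi_mem β h x)
  have hfix' : qPhi β h c = c := hfix
  have hc0 : c ≠ 0 := by
    intro hc0
    rw [hc0, qPhi_zero] at hfix'
    have : Real.tanh h = 0 := by simpa using hfix'
    rw [Real.tanh_eq_sinh_div_cosh, div_eq_zero_iff] at this
    rcases this with h1 | h1
    · exact h0 (Real.sinh_eq_zero.1 h1)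
    · exact (Real.cosh_pos h).ne' h1
  have hS : {q : ℝ | q ∈ Set.Ioc (0 : ℝ) 1 ∧
      q = ∫ g, Real.tanh (β * g * Real.sqrt q + h) ^ 2 ∂stdGaussian} = {c} := by
    ext q
    rw [Set.mem_singleton_iff]
    constructor
    · rintro ⟨hq, hq2⟩
      have hq3 : q = qPhi β h q := hq2
      have := qPhi_lip β h q c hq.1.le hc.1
      rw [← hq3, hfix'] at this
      by_contra hne
      have := abs_pos.2 (sub_ne_zero.2 hne)
      nlinarith
    · rintro rfl
      exact ⟨⟨lt_of_le_of_ne hc.1 (Ne.symm hc0), hc.2⟩, hfix'.symm⟩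
  have : qOverlap β h = c := by
    rw [qOverlap, if_neg h0, hS, csSup_singleton]
  rw [this]
  exact ⟨hc.1, hc.2, hfix'.symm⟩

lemma q1_eq (β h : ℝ) : q1 β h = mPhi β h (qOverlap β h) := rfl

/-- Lipschitz constant of `q1` in `h` -/
def q1L (β : ℝ) : ℝ := 2 / (1 - β ^ 2) + 1

lemma q1_lip (β h h' : ℝ) (hβ0 : 0 < β) (hβ1 : β < 1) :
    |q1 β h - q1 β h'| ≤ q1L β * |h - h'| := by
  have hβ2 : β ^ 2 < 1 := by nlinarith
  obtain ⟨a0, -, a2⟩ := qOverlap_spec β h hβ0 hβ1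
  obtain ⟨b0, -, b2⟩ := qOverlap_spec β h' hβ0 hβ1
  set q := qOverlap β h
  set q' := qOverlap β h'
  have h1 := qPhi_lip β h q q' a0 b0
  have h2 := qPhi_lip_h β h h' q'
  have h3 : |q - q'| ≤ β ^ 2 * |q - q'| + 2 * |h - h'| := by
    calc |q - q'| = |(qPhi β h q - qPhi β h q') + (qPhi β h q' - qPhi β h' q')| := by
          rw [← a2, ← b2]; congr 1; ring
      _ ≤ _ := (abs_add_le _ _).trans (add_le_add h1 h2)
  have h4 : |q - q'| ≤ 2 / (1 - β ^ 2) * |h - h'| := by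
    have : 0 < 1 - β ^ 2 := by linarith
    rw [div_mul_eq_mul_div, le_div_iff₀ this]
    linarith
  have h5 := mPhi_lip β h q q' a0 b0
  have h6 := mPhi_lip_h β h h' q'
  have h7 : β ^ 2 * |q - q'| ≤ |q - q'| := by nlinarith [abs_nonneg (q - q')]
  calc |q1 β h - q1 β h'| = |(mPhi β h q - mPhi β h q') + (mPhi β h q' - mPhi β h' q')| := by
        rw [q1_eq, q1_eq]; congr 1; ring
    _ ≤ β ^ 2 * |q - q'| + |h - h'| := (abs_add_le _ _).trans (add_le_add h5 h6)
    _ ≤ _ := by unfold q1L; linarith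

lemma tanh_abs_le (h : ℝ) : |Real.tanh h| ≤ |h| := by
  have := tanh_lip h 0
  simpa using this

lemma q1_tanh (β h : ℝ) (hβ0 : 0 < β) (hβ1 : β < 1) :
    |q1 β h - Real.tanh h| ≤ 1 / (1 - β ^ 2) * h ^ 2 := by
  have hβ2 : β ^ 2 < 1 := by nlinarith
  have hβ3 : 0 < 1 - β ^ 2 := by linarith
  obtain ⟨a0, -, a2⟩ := qOverlap_spec β h hβ0 hβ1
  set q := qOverlap β h
  have h1 := qPhi_lip β h q 0 a0 le_rfl
  rw [← a2, qPhi_zero, sub_zero, abs_of_nonneg a0] at h1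
  have h2 := (abs_le.1 h1).2
  have h3 : Real.tanh h ^ 2 ≤ h ^ 2 := sq_le_sq.2 (tanh_abs_le h)
  have h4 : q ≤ 1 / (1 - β ^ 2) * h ^ 2 := by
    rw [one_div, inv_mul_eq_div, le_div_iff₀ hβ3]
    linarith
  have h5 := mPhi_lip β h q 0 a0 le_rfl
  rw [mPhi_zero, sub_zero, abs_of_nonneg a0] at h5
  rw [q1_eq]
  refine h5.trans (le_trans ?_ h4)
  nlinarith

lemma tanh_ge (h : ℝ) (hh : 0 ≤ h) : h - h ^ 2 ≤ Real.tanh h := by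
  by_cases h1 : h ≤ 1
  swap
  · have : 0 ≤ Real.tanh h := by
      rw [Real.tanh_eq_sinh_div_cosh]
      exact div_nonneg (Real.sinh_nonneg_iff.2 hh) (Real.cosh_pos h).le
    nlinarith
  have := Convex.norm_image_sub_le_of_norm_hasDerivWithin_le (f := fun x => Real.tanh x - x)
    (f' := fun x => -Real.tanh x ^ 2) (C := h) (s := Set.Icc 0 h)
    (fun x _ => (((tanh_hasDerivAt x).sub (hasDerivAt_id x)).congr_deriv (by simp)).hasDerivWithinAt)
    (fun x hx => by
      have h2 := tanh_abs_le x
      rw [abs_of_nonneg hx.1] at h2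
      rw [Real.norm_eq_abs, abs_neg, abs_pow]
      have h3 := abs_nonneg (Real.tanh x)
      nlinarith [hx.1, hx.2]) (convex_Icc 0 h) (Set.left_mem_Icc.2 hh) (Set.right_mem_Icc.2 hh)
  simp [abs_of_nonneg hh] at this
  have := (abs_le.1 this).1
  nlinarith

lemma q1_ge (β h : ℝ) (hβ0 : 0 < β) (hβ1 : β < 1) (hh : 0 ≤ h)
    (hs : h * (1 / (1 - β ^ 2) + 1) ≤ 1 / 2) : h / 2 ≤ q1 β h := by
  have h1 := (abs_le.1 (q1_tanh β h hβ0 hβ1)).1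
  have h2 := tanh_ge h hh
  nlinarith

lemma q1_nonneg_small (β : ℝ) : q1 β 0 = 0 := by simp [q1_eq, qOverlap, mPhi_zero]

end qfacts

/-! ### Disorder space, monotonicity, gauge symmetry -/

section disorder
variable {N : ℕ}

/-- the disorder space -/
abbrev DS (N : ℕ) : Type := (Fin N × Fin N) ⊕ Fin N → ℝ

abbrev DP (N : ℕ) : Measure (DS N) := gamPi ((Fin N × Fin N) ⊕ Fin N)

def skU (β : ℝ) (y : DS N) (σ : Fin N → Bool) : ℝ :=
  ∑ p : Fin N × Fin N, y (Sum.inl p) *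
    (β / Real.sqrt (2 * N) * wc p.1 p.2 * (spin (σ p.1) * spin (σ p.2)))

def skV (β : ℝ) (y : DS N) (h : ℝ) (σ : Fin N → Bool) : ℝ := skU β y σ + h * magS σ

/-- mean magnetization as a function of the Gaussian disorder -/
def mm (β : ℝ) (y : DS N) (h : ℝ) : ℝ := gav (skV β y h) magS / N

lemma iV_one (β q h : ℝ) (y : DS N) :
    iV (skφ N β q) (fun σ => h * magS σ) (cI (Real.pi / 2)) y = skV β y h := by
  funext σ
  simp only [iV, Fintype.sum_sum_type, cI, Sum.elim_inl, Sum.elim_inr, Real.sin_pi_div_two,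
    Real.cos_pi_div_two, skφ, skV, skU, zero_mul, Finset.sum_const_zero, add_zero, one_mul]

lemma continuous_skV (β h : ℝ) (σ : Fin N → Bool) : Continuous fun y => skV β y h σ := by
  unfold skV skU; fun_prop

lemma continuous_pairV (β h : ℝ) (a : (Fin N → Bool) × (Fin N → Bool)) :
    Continuous fun y => pairW (skV β y h) a :=
  (continuous_skV β h a.1).add (continuous_skV β h a.2)

/-- the log-ratio -/
def LL (β q m : ℝ) (y : DS N) (h : ℝ) : ℝ :=
  lse (fun a => pairW (skV β y h) a + skF N β (k1 β) q m a) - lse (pairW (skV β y h))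

lemma LL_eq (β q m : ℝ) (y : DS N) (h : ℝ) :
    iL (fun k => pairSum (skφ N β q k)) (pairSum (fun σ => h * magS σ))
        (skF N β (k1 β) q m) (cI (Real.pi / 2)) y = LL β q m y h := by
  rw [iL, iV_pair, iV_one, LL]

lemma continuous_LL (β q m h : ℝ) : Continuous fun y : DS N => LL β q m y h := by
  unfold LL
  refine (continuous_lse fun a => ?_).sub (continuous_lse fun a => continuous_pairV β h a)
  exact (continuous_pairV β h a).add continuous_const

lemma integrable_exp_LL (β q m h p : ℝ) :
    Integrable (fun y : DS N => Real.exp (p * LL β q m y h)) (DP N) := by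
  obtain ⟨C, hC⟩ : ∃ C, ∀ a, |skF N β (k1 β) q m a| ≤ C := by
    refine ⟨∑ a, |skF N β (k1 β) q m a|, fun a => ?_⟩
    exact Finset.single_le_sum (f := fun a => |skF N β (k1 β) q m a|) (fun a _ => abs_nonneg _)
      (Finset.mem_univ a)
  refine Integrable.of_bound (C := Real.exp (|p| * C)) ?_ (Filter.Eventually.of_forall fun y => ?_)
  · refine Continuous.aestronglyMeasurable ?_
    have := continuous_LL (N := N) β q m h
    fun_prop
  · rw [Real.norm_eq_abs, Real.abs_exp, Real.exp_le_exp]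
    refine (le_abs_self _).trans ?_
    rw [abs_mul]
    exact mul_le_mul_of_nonneg_left (lse_sub_abs_le hC) (abs_nonneg _)

lemma consts_pos (β : ℝ) (hβ0 : 0 < β) (hβ1 : β < 1) : 0 < klam β ∧ 0 < k1 β ∧ 0 < kp β ∧ kp β ≤ 1 := by
  have hβ2 : β ^ 2 < 1 := by nlinarith
  have h01 : k0 β < 1 := by unfold k0; linarith
  have h20 : 0 < k2 β := by unfold k2 k0; positivity
  have h02 : k0 β < k2 β := by unfold k2; linarith
  have hα1 : kα β < 1 := (div_lt_one h20).2 h02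
  have hk1 : 0 < k1 β := by unfold k1 k0; linarith
  refine ⟨by unfold klam; linarith, hk1, Real.exp_pos _, ?_⟩
  unfold kp
  rw [Real.exp_le_one_iff]
  have : 0 < k0 β - β ^ 2 := hk1
  have : 0 ≤ 3 * β ^ 2 / (k0 β - β ^ 2) := by positivity
  linarith

lemma moment_q1 (hN : 0 < N) (β h : ℝ) (hβ0 : 0 < β) (hβ1 : β < 1) :
    ∫ y, Real.exp (kp β * LL β (qOverlap β h) (q1 β h) y h) ∂DP N ≤ kC β := by
  obtain ⟨a0, a1, a2⟩ := qOverlap_spec β h hβ0 hβ1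
  have := sk_moment hN β h (qOverlap β h) (q1 β h) hβ0 hβ1 a0 a1 a2 rfl
  simpa only [LL_eq] using this

lemma gav_sq_ge {A : Type*} [Fintype A] [Nonempty A] (u f : A → ℝ) :
    gav u f ^ 2 ≤ gav u (fun a => f a ^ 2) := by
  set c := gav u f with hc
  have h1 : ∀ a, 2 * c * f a - c ^ 2 ≤ f a ^ 2 := fun a => by nlinarith [sq_nonneg (f a - c)]
  have h2 := gav_mono u h1
  rw [gav_sub, gav_const_mul, gav_const, ← hc] at h2
  linarith

lemma LL_ge (hN : 0 < N) (β q m h : ℝ) (hβ0 : 0 < β) (hβ1 : β < 1) (y : DS N) :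
    klam β * (N / 2 * (mm β y h - m) ^ 2) ≤ LL β q m y h := by
  obtain ⟨hl, hk1, -, -⟩ := consts_pos β hβ0 hβ1
  refine le_trans ?_ (gav_le_lse _ _)
  have h1 : ∀ a, klam β * ((N : ℝ) / 2 * (magS a.1 / N - m) ^ 2) ≤ skF N β (k1 β) q m a := by
    intro a
    unfold skF
    have : 0 ≤ k1 β * ((N : ℝ) / 2 * (overlap a.1 a.2 - q) ^ 2) := by positivity
    linarith
  refine le_trans ?_ (gav_mono _ h1)
  rw [gav_const_mul, gav_const_mul, gav_pair_fst _ (fun σ => (magS σ / N - m) ^ 2)]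
  have h2 := gav_sq_ge (skV β y h) (fun σ => magS σ / N - m)
  rw [gav_sub, gav_const] at h2
  simp only [div_eq_mul_inv, gav_mul_const] at h2 ⊢
  unfold mm
  rw [div_eq_mul_inv]
  have : 0 ≤ (N : ℝ) * 2⁻¹ := by positivity
  exact mul_le_mul_of_nonneg_left (mul_le_mul_of_nonneg_left h2 this) hl.le

/-- tail bound for the magnetization -/
lemma mm_tail (hN : 0 < N) (β h t : ℝ) (hβ0 : 0 < β) (hβ1 : β < 1) (ht : 0 ≤ t) :
    DP N {y | t ≤ |mm β y h - q1 β h|} ≤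
      ENNReal.ofReal (kC β * Real.exp (-(kp β * klam β / 2 * N * t ^ 2))) := by
  obtain ⟨hl, hk1, hp, -⟩ := consts_pos β hβ0 hβ1
  set s := Real.exp (kp β * klam β / 2 * N * t ^ 2) with hs
  have hs0 : 0 < s := Real.exp_pos _
  have hm := mul_meas_ge_le_integral_of_nonneg (μ := DP N)
    (f := fun y => Real.exp (kp β * LL β (qOverlap β h) (q1 β h) y h))
    (Filter.Eventually.of_forall fun y => (Real.exp_pos _).le) (integrable_exp_LL _ _ _ _ _) s
  have hsub : {y : DS N | t ≤ |mm β y h - q1 β h|} ⊆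
      {y | s ≤ Real.exp (kp β * LL β (qOverlap β h) (q1 β h) y h)} := by
    intro y hy
    have hy : t ≤ |mm β y h - q1 β h| := hy
    show s ≤ _
    rw [hs, Real.exp_le_exp]
    have h1 := LL_ge hN β (qOverlap β h) (q1 β h) h hβ0 hβ1 y
    have h2 : t ^ 2 ≤ (mm β y h - q1 β h) ^ 2 := by
      rw [← sq_abs (mm β y h - q1 β h)]
      exact pow_le_pow_left₀ ht hy 2
    have h3 := mul_le_mul_of_nonneg_left h1 hp.le
    refine le_trans ?_ h3
    have : kp β * klam β / 2 * N * t ^ 2 = kp β * (klam β * (N / 2 * t ^ 2)) := by ring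
    rw [this]
    gcongr
  have h4 : (DP N).real {y | t ≤ |mm β y h - q1 β h|} ≤ kC β * Real.exp (-(kp β * klam β / 2 * N * t ^ 2)) := by
    rw [Real.exp_neg, ← hs, ← div_eq_mul_inv, le_div_iff₀ hs0, mul_comm]
    refine le_trans ?_ (hm.trans (moment_q1 hN β h hβ0 hβ1))
    refine mul_le_mul_of_nonneg_left ?_ hs0.le
    exact measureReal_mono hsub
  rw [← ofReal_measureReal]
  exact ENNReal.ofReal_le_ofReal h4

/-- log-partition function -/
def LZ (β : ℝ) (y : DS N) (h : ℝ) : ℝ := lse (skV β y h)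

lemma LZ_lower (hN : 0 < N) (β h η : ℝ) (y : DS N) :
    η * N * mm β y h ≤ LZ β y (h + η) - LZ β y h := by
  have hN' : (N : ℝ) ≠ 0 := by exact_mod_cast hN.ne'
  have := gav_le_lse (skV β y h) (fun σ => η * magS σ)
  rw [gav_const_mul] at this
  have e : (fun σ => skV β y h σ + η * magS σ) = skV β y (h + η) := by
    funext σ; unfold skV; ring
  rw [e] at this
  refine le_trans (le_of_eq ?_) this
  unfold mm; field_simp

lemma LZ_upper (hN : 0 < N) (β h η : ℝ) (y : DS N) :
    LZ β y (h + η) - LZ β y h ≤ η * N * mm β y (h + η) := by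
  have := LZ_lower hN β (h + η) (-η) y
  rw [add_neg_cancel_right] at this
  linarith

lemma mm_mono (hN : 0 < N) (β h h' : ℝ) (y : DS N) (hh : h ≤ h') : mm β y h ≤ mm β y h' := by
  rcases hh.eq_or_lt with rfl | hlt
  · exact le_rfl
  have hN' : (0 : ℝ) < N := by exact_mod_cast hN
  have h1 := LZ_lower hN β h (h' - h) y
  have h2 := LZ_upper hN β h (h' - h) y
  rw [add_sub_cancel] at h1 h2
  have h3 : 0 < (h' - h) * N := mul_pos (by linarith) hN'
  exact le_of_mul_le_mul_left (h1.trans h2) h3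

/-! Gauge symmetry -/

lemma spin_beq (b c : Bool) : spin (b == c) = spin b * spin c := by
  cases b <;> cases c <;> simp [spin]

def flipE (τ : Fin N → Bool) : (Fin N → Bool) ≃ (Fin N → Bool) :=
  Function.Involutive.toPerm (fun σ i => (τ i == σ i)) (fun σ => by
    funext i; cases h : τ i <;> cases h' : σ i <;> simp [h, h'])

lemma spin_flipE (τ σ : Fin N → Bool) (i : Fin N) : spin (flipE τ σ i) = spin (τ i) * spin (σ i) := by
  show spin (τ i == σ i) = _
  exact spin_beq _ _

lemma flipE_flipE (τ σ : Fin N → Bool) : flipE τ (flipE τ σ) = σ := by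
  funext i
  show (τ i == (τ i == σ i)) = σ i
  cases τ i <;> cases σ i <;> rfl

lemma gav_equiv {A B : Type*} [Fintype A] [Fintype B] (e : A ≃ B) (u g : B → ℝ) :
    gav (fun a => u (e a)) (fun a => g (e a)) = gav u g := by
  unfold gav
  rw [Equiv.sum_comp e (fun b => g b * Real.exp (u b)), Equiv.sum_comp e (fun b => Real.exp (u b))]

/-- gauge transformation of the disorder -/
def gaug (τ : Fin N → Bool) (y : DS N) : DS N :=
  fun k => Sum.elim (fun p => spin (τ p.1) * spin (τ p.2)) (fun _ => 1) k * y k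

lemma gauge_mp (τ : Fin N → Bool) : MeasurePreserving (gaug τ) (DP N) (DP N) := by
  refine measurePreserving_pi (f := fun k (t : ℝ) =>
    Sum.elim (fun p : Fin N × Fin N => spin (τ p.1) * spin (τ p.2)) (fun _ : Fin N => (1 : ℝ)) k * t)
    _ _ fun k => ⟨by fun_prop, ?_⟩
  rw [gaussianReal_map_const_mul]
  simp only [mul_zero, mul_one]
  congr 1
  apply NNReal.eq
  show (_ : ℝ) ^ 2 = 1
  rcases k with p | i
  · simp only [Sum.elim_inl]
    rw [mul_pow, sq, sq, spin_mul_self, spin_mul_self, mul_one]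
  · simp

lemma skU_gauge (β : ℝ) (τ : Fin N → Bool) (y : DS N) (σ : Fin N → Bool) :
    skU β (gaug τ y) σ = skU β y (flipE τ σ) := by
  unfold skU
  refine Finset.sum_congr rfl fun p _ => ?_
  simp only [gaug, Sum.elim_inl, spin_flipE]
  ring

lemma skV_zero (β : ℝ) (y : DS N) : skV β y 0 = skU β y := by
  funext σ; simp [skV]

/-- gauge averaging for pair observables -/
lemma gauge_avg (β : ℝ) (f : (Fin N → Bool) × (Fin N → Bool) → ℝ) :
    ∫ y, gav (pairW (skU β y)) f ∂DP N =
      ∫ y, gav (pairW (skU β y)) (fun a => (∑ τ : Fin N → Bool, f (flipE τ a.1, flipE τ a.2)) / 2 ^ N) ∂DP N := by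
  have hc : ∀ g, Continuous fun y : DS N => gav (pairW (skU β y)) g := fun g => by
    refine continuous_gav g fun a => ?_
    simpa only [skV_zero] using continuous_pairV β 0 a
  have hi : ∀ g, Integrable (fun y : DS N => gav (pairW (skU β y)) g) (DP N) := fun g => by
    refine Integrable.of_bound (C := ∑ a, |g a|) (hc g).aestronglyMeasurable
      (Filter.Eventually.of_forall fun y => ?_)
    exact gav_abs_le _ fun a => Finset.single_le_sum (f := fun a => |g a|) (fun a _ => abs_nonneg _)
      (Finset.mem_univ a)
  have key : ∀ τ : Fin N → Bool, ∫ y, gav (pairW (skU β y)) f ∂DP N =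
      ∫ y, gav (pairW (skU β y)) (fun a => f (flipE τ a.1, flipE τ a.2)) ∂DP N := by
    intro τ
    rw [← (gauge_mp τ).map_eq, integral_map (gauge_mp τ).aemeasurable
      (hc _).aestronglyMeasurable, (gauge_mp τ).map_eq]
    refine integral_congr_ae (Filter.Eventually.of_forall fun y => ?_)
    show gav (pairW (skU β (gaug τ y))) f = gav (pairW (skU β y)) _
    rw [← gav_equiv (Equiv.prodCongr (flipE τ) (flipE τ)) (pairW (skU β (gaug τ y))) f]
    congr 1
    funext a
    simp only [pairW, skU_gauge, Equiv.prodCongr_apply, Prod.map, flipE_flipE]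
  have h2 : (2 : ℝ) ^ N ≠ 0 := by positivity
  simp only [div_eq_mul_inv, gav_mul_const, gav_sum]
  rw [integral_mul_const, integral_finsetSum _ fun τ _ => hi _, ← Finset.sum_congr rfl fun τ _ => key τ]
  simp
  field_simp

/-- ratio of partition functions -/
def QQ (β : ℝ) (y : DS N) (h : ℝ) : ℝ :=
  gav (skU β y) (fun σ => ∏ i, (1 + Real.tanh h * spin (σ i)))

lemma QQ_eq (β : ℝ) (y : DS N) (h : ℝ) :
    QQ β y h * Real.cosh h ^ N = Real.exp (LZ β y h - LZ β y 0) := by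
  have e : (fun σ => skV β y 0 σ + h * magS σ) = skV β y h := by
    funext σ; unfold skV; ring
  rw [LZ, LZ, ← e, ← gav_exp, skV_zero, QQ, ← gav_mul_const]
  congr 1
  funext σ
  rw [magS, Finset.mul_sum, Real.exp_sum]
  have : Real.cosh h ^ N = ∏ i : Fin N, Real.cosh h := by simp
  rw [this, ← Finset.prod_mul_distrib]
  refine Finset.prod_congr rfl fun i _ => ?_
  have hc := (Real.cosh_pos h).ne'
  rw [Real.tanh_eq_sinh_div_cosh, exp_spin]
  field_simp

lemma exp_mul_le_lin (s x : ℝ) (h0 : 0 ≤ s) (h1 : s ≤ 1) :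
    Real.exp (s * x) ≤ 1 + s * (Real.exp x - 1) := by
  have := convexOn_exp.2 (Set.mem_univ (0 : ℝ)) (Set.mem_univ x) (by linarith : 0 ≤ 1 - s) h0
    (by ring)
  simp at this
  linarith

lemma gav_exp_pow_le {A : Type*} [Fintype A] [Nonempty A] (u f : A → ℝ) (p : ℝ) (h0 : 0 ≤ p)
    (h1 : p ≤ 1) : gav u (fun a => Real.exp (p * f a)) ≤
      Real.exp (p * (lse (fun a => u a + f a) - lse u)) := by
  set L := lse (fun a => u a + f a) - lse u with hL
  have hp : ∀ a, Real.exp (p * f a) ≤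
      Real.exp (p * L) * ((1 - p) + p * (Real.exp (-L) * Real.exp (f a))) := by
    intro a
    have := exp_mul_le_lin p (f a - L) h0 h1
    have e : Real.exp (p * f a) = Real.exp (p * L) * Real.exp (p * (f a - L)) := by
      rw [← Real.exp_add]; congr 1; ring
    rw [e]
    refine mul_le_mul_of_nonneg_left ?_ (Real.exp_pos _).le
    have e2 : Real.exp (-L) * Real.exp (f a) = Real.exp (f a - L) := by
      rw [← Real.exp_add]; congr 1; ring
    rw [e2]
    linarith
  refine (gav_mono u hp).trans (le_of_eq ?_)
  rw [gav_const_mul, gav_add, gav_const, gav_const_mul, gav_const_mul, gav_exp, ← hL, ← Real.exp_add]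
  simp

lemma flip_avg (t : ℝ) (σ ρ : Fin N → Bool) :
    (∑ τ : Fin N → Bool, (∏ i, (1 + t * spin (flipE τ σ i)) - 1) *
      (∏ i, (1 + t * spin (flipE τ ρ i)) - 1)) / 2 ^ N =
      ∏ i, (1 + t ^ 2 * (spin (σ i) * spin (ρ i))) - 1 := by
  have h2 : (2 : ℝ) ^ N ≠ 0 := by positivity
  have hsf : spin false = -1 := by simp [spin]
  have hst : spin true = 1 := by simp [spin]
  have hs : ∀ σ : Fin N → Bool, ∑ τ : Fin N → Bool, ∏ i, (1 + t * spin (flipE τ σ i)) = 2 ^ N := by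
    intro σ
    simp only [spin_flipE]
    rw [sum_conf_prod (fun i b => 1 + t * (spin b * spin (σ i)))]
    have : ∀ i, (1 + t * (spin true * spin (σ i))) + (1 + t * (spin false * spin (σ i))) = (2 : ℝ) := by
      intro i; rw [hst, hsf]; ring
    simp [this]
  have hs2 : ∑ τ : Fin N → Bool, (∏ i, (1 + t * spin (flipE τ σ i))) *
      (∏ i, (1 + t * spin (flipE τ ρ i))) = 2 ^ N * ∏ i, (1 + t ^ 2 * (spin (σ i) * spin (ρ i))) := by
    simp only [spin_flipE, ← Finset.prod_mul_distrib]
    rw [sum_conf_prod (fun i b => (1 + t * (spin b * spin (σ i))) * (1 + t * (spin b * spin (ρ i))))]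
    have : (2 : ℝ) ^ N = ∏ i : Fin N, 2 := by simp
    rw [this, ← Finset.prod_mul_distrib]
    refine Finset.prod_congr rfl fun i _ => ?_
    rw [hst, hsf]; ring
  have e : ∀ τ : Fin N → Bool, (∏ i, (1 + t * spin (flipE τ σ i)) - 1) *
      (∏ i, (1 + t * spin (flipE τ ρ i)) - 1) =
      (∏ i, (1 + t * spin (flipE τ σ i))) * (∏ i, (1 + t * spin (flipE τ ρ i))) -
      (∏ i, (1 + t * spin (flipE τ σ i))) - (∏ i, (1 + t * spin (flipE τ ρ i))) + 1 := by
    intro τ; ring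
  simp only [e, Finset.sum_add_distrib, Finset.sum_sub_distrib, hs, hs2]
  simp
  field_simp

lemma pair_cosh (β : ℝ) (y : DS N) (c : ℝ) :
    gav (pairW (skU β y)) (fun a => Real.exp (c * ∑ i, spin (a.1 i) * spin (a.2 i))) ≤
      gav (pairW (skU β y)) (fun a => Real.exp ((c * ∑ i, spin (a.1 i) * spin (a.2 i)) ^ 2 / 2)) := by
  set g : (Fin N → Bool) × (Fin N → Bool) → ℝ := fun a =>
    Real.exp (c * ∑ i, spin (a.1 i) * spin (a.2 i)) with hg
  have h1 : gav (pairW (skU β y)) g = gav (pairW (skU β y))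
      (fun a => Real.exp (-(c * ∑ i, spin (a.1 i) * spin (a.2 i)))) := by
    rw [← gav_equiv (Equiv.prodCongr (Equiv.refl _) (flipE fun _ => false)) (pairW (skU β y)) g]
    have hsf : spin false = -1 := by simp [spin]
    have hU : ∀ σ, skU β y (flipE (fun _ => false) σ) = skU β y σ := by
      intro σ
      simp only [skU, spin_flipE, hsf]
      refine Finset.sum_congr rfl fun p _ => by ring
    congr 1
    · funext a
      simp only [pairW, Equiv.prodCongr_apply, Prod.map, Equiv.refl_apply, hU]
    · funext a
      simp only [hg, Equiv.prodCongr_apply, Prod.map, Equiv.refl_apply, spin_flipE, hsf]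
      congr 1
      rw [← mul_neg, ← Finset.sum_neg_distrib]
      congr 1
      refine Finset.sum_congr rfl fun i _ => by ring
  have h2 : gav (pairW (skU β y)) g = gav (pairW (skU β y))
      (fun a => Real.cosh (c * ∑ i, spin (a.1 i) * spin (a.2 i))) := by
    have : gav (pairW (skU β y)) g = (gav (pairW (skU β y)) g + gav (pairW (skU β y))
      (fun a => Real.exp (-(c * ∑ i, spin (a.1 i) * spin (a.2 i))))) * 2⁻¹ := by
      rw [← h1]; ring
    rw [this, ← gav_add, ← gav_mul_const]
    congr 1; funext a
    rw [Real.cosh_eq, div_eq_mul_inv]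
  rw [h2]
  exact gav_mono _ fun a => Real.cosh_le_exp_half_sq _

lemma second_moment_ptw (hN : 0 < N) (β h : ℝ) (hβ0 : 0 < β) (hβ1 : β < 1)
    (hs : N * (Real.tanh h ^ 2) ^ 2 / k1 β ≤ kp β) (y : DS N) :
    gav (pairW (skU β y)) (fun a => ∏ i, (1 + Real.tanh h ^ 2 * (spin (a.1 i) * spin (a.2 i))) - 1) ≤
      N * (Real.tanh h ^ 2) ^ 2 / (k1 β * kp β) * Real.exp (kp β * LL β 0 0 y 0) := by
  obtain ⟨hl, hk1, hp, hp1⟩ := consts_pos β hβ0 hβ1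
  have hN' : (0 : ℝ) < N := by exact_mod_cast hN
  set T := Real.tanh h ^ 2 with hT
  have hT0 : 0 ≤ T := sq_nonneg _
  have hT1 : T ≤ 1 := (Real.tanh_sq_lt_one h).le
  set θ := N * T ^ 2 / k1 β with hθ
  have hθ0 : 0 ≤ θ := by positivity
  have e1 : ∀ a : (Fin N → Bool) × (Fin N → Bool),
      ∏ i, (1 + T * (spin (a.1 i) * spin (a.2 i))) ≤
      Real.exp (T * ∑ i, spin (a.1 i) * spin (a.2 i)) := by
    intro a
    rw [Finset.mul_sum, Real.exp_sum]
    refine Finset.prod_le_prod (fun i _ => ?_) (fun i _ => ?_)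
    · have : -1 ≤ spin (a.1 i) * spin (a.2 i) := by
        cases a.1 i <;> cases a.2 i <;> simp [spin]
      nlinarith
    · rw [add_comm]; exact Real.add_one_le_exp _
  have e2 : ∀ a : (Fin N → Bool) × (Fin N → Bool),
      Real.exp ((T * ∑ i, spin (a.1 i) * spin (a.2 i)) ^ 2 / 2) ≤
      1 + θ / kp β * (Real.exp (kp β * skF N β (k1 β) 0 0 a) - 1) := by
    intro a
    refine le_trans ?_ (exp_mul_le_lin _ _ (by positivity) ((div_le_one hp).2 hs))
    rw [Real.exp_le_exp]
    have h1 : (T * ∑ i, spin (a.1 i) * spin (a.2 i)) ^ 2 / 2 =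
        θ * (k1 β * ((N : ℝ) / 2 * (overlap a.1 a.2 - 0) ^ 2)) := by
      rw [hθ, overlap]; field_simp; ring
    have h2 : θ / kp β * (kp β * skF N β (k1 β) 0 0 a) = θ * skF N β (k1 β) 0 0 a := by
      field_simp
    rw [h1, h2]
    refine mul_le_mul_of_nonneg_left ?_ hθ0
    unfold skF
    have : 0 ≤ klam β * ((N : ℝ) / 2 * (magS a.1 / N - 0) ^ 2) := by positivity
    linarith
  rw [gav_sub, gav_const]
  have s1 := (gav_mono (pairW (skU β y)) e1).trans ((pair_cosh β y T).trans
    (gav_mono (pairW (skU β y)) e2))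
  rw [gav_add, gav_const, gav_const_mul, gav_sub, gav_const] at s1
  have s2 := gav_exp_pow_le (pairW (skU β y)) (skF N β (k1 β) 0 0) (kp β) hp.le hp1
  have s3 : LL β 0 0 y 0 = lse (fun a => pairW (skU β y) a + skF N β (k1 β) 0 0 a) -
      lse (pairW (skU β y)) := by rw [LL, skV_zero]
  rw [← s3] at s2
  have s4 : N * T ^ 2 / (k1 β * kp β) = θ / kp β := by rw [hθ]; field_simp
  rw [s4]
  have s5 : 0 ≤ θ / kp β := by positivity
  nlinarith [mul_le_mul_of_nonneg_left s2 s5]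

lemma continuous_QQ (β h : ℝ) : Continuous fun y : DS N => QQ β y h := by
  unfold QQ
  refine continuous_gav _ fun a => ?_
  simpa only [skV_zero] using continuous_skV β 0 a

lemma integrable_QQ (β h : ℝ) : Integrable (fun y : DS N => (QQ β y h - 1) ^ 2) (DP N) := by
  have hc := continuous_QQ (N := N) β h
  set g : (Fin N → Bool) → ℝ := fun σ => ∏ i, (1 + Real.tanh h * spin (σ i))
  refine Integrable.of_bound (C := (∑ a, |g a| + 1) ^ 2)
    (Continuous.aestronglyMeasurable (by fun_prop))
    (Filter.Eventually.of_forall fun y => ?_)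
  rw [Real.norm_eq_abs, abs_pow]
  refine pow_le_pow_left₀ (abs_nonneg _) ?_ 2
  refine (abs_sub _ _).trans ?_
  rw [abs_one]
  have : |QQ β y h| ≤ ∑ a, |g a| :=
    gav_abs_le _ fun a => Finset.single_le_sum (f := fun a => |g a|) (fun a _ => abs_nonneg _)
      (Finset.mem_univ a)
  linarith

lemma second_moment (hN : 0 < N) (β h : ℝ) (hβ0 : 0 < β) (hβ1 : β < 1)
    (hs : N * (Real.tanh h ^ 2) ^ 2 / k1 β ≤ kp β) :
    ∫ y, (QQ β y h - 1) ^ 2 ∂DP N ≤ N * (Real.tanh h ^ 2) ^ 2 / (k1 β * kp β) * kC β := by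
  obtain ⟨hl, hk1, hp, hp1⟩ := consts_pos β hβ0 hβ1
  have e1 : ∀ y : DS N, (QQ β y h - 1) ^ 2 = gav (pairW (skU β y)) (fun a =>
      (∏ i, (1 + Real.tanh h * spin (a.1 i)) - 1) * (∏ i, (1 + Real.tanh h * spin (a.2 i)) - 1)) := by
    intro y
    rw [gav_pair (skU β y) (fun σ ρ => (∏ i, (1 + Real.tanh h * spin (σ i)) - 1) *
      (∏ i, (1 + Real.tanh h * spin (ρ i)) - 1))]
    simp only [gav_const_mul, gav_mul_const, gav_sub, gav_const]
    rw [sq]; rfl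
  simp only [e1]
  rw [gauge_avg]
  simp only [flip_avg]
  have h0 := moment_q1 hN β 0 hβ0 hβ1
  have hq0 : qOverlap β 0 = 0 := by simp [qOverlap]
  rw [hq0, q1_nonneg_small] at h0
  have hk : 0 ≤ N * (Real.tanh h ^ 2) ^ 2 / (k1 β * kp β) := by positivity
  refine le_trans ?_ (mul_le_mul_of_nonneg_left h0 hk)
  rw [← integral_const_mul]
  refine integral_mono ?_ ((integrable_exp_LL _ _ _ _ _).const_mul _)
    (fun y => second_moment_ptw hN β h hβ0 hβ1 hs y)
  set g : (Fin N → Bool) × (Fin N → Bool) → ℝ :=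
    fun a => ∏ i, (1 + Real.tanh h ^ 2 * (spin (a.1 i) * spin (a.2 i))) - 1
  refine Integrable.of_bound (C := ∑ a, |g a|) (Continuous.aestronglyMeasurable ?_)
      (Filter.Eventually.of_forall fun y => ?_)
  · refine continuous_gav g fun a => ?_
    simpa only [skV_zero] using continuous_pairV β 0 a
  · exact gav_abs_le _ fun a => Finset.single_le_sum (f := fun a => |g a|) (fun a _ => abs_nonneg _)
      (Finset.mem_univ a)

/-- Chebyshev bound for the ratio of partition functions -/
lemma QQ_tail (hN : 0 < N) (β h t : ℝ) (hβ0 : 0 < β) (hβ1 : β < 1) (ht : 0 < t)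
    (hs : N * h ^ 4 / k1 β ≤ kp β) :
    DP N {y | t ≤ |QQ β y h - 1|} ≤
      ENNReal.ofReal (N * h ^ 4 / (k1 β * kp β) * kC β / t ^ 2) := by
  obtain ⟨hl, hk1, hp, hp1⟩ := consts_pos β hβ0 hβ1
  have hkC : 0 ≤ kC β := by
    unfold kC
    exact add_nonneg (integral_nonneg fun _ => (Real.exp_pos _).le)
      (integral_nonneg fun _ => (Real.exp_pos _).le)
  have hT : (Real.tanh h ^ 2) ^ 2 ≤ h ^ 4 := by
    have h3 : Real.tanh h ^ 2 ≤ h ^ 2 := sq_le_sq.2 (tanh_abs_le h)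
    calc (Real.tanh h ^ 2) ^ 2 ≤ (h ^ 2) ^ 2 := pow_le_pow_left₀ (sq_nonneg _) h3 2
      _ = h ^ 4 := by ring
  have hs' : N * (Real.tanh h ^ 2) ^ 2 / k1 β ≤ kp β := le_trans (by gcongr) hs
  have hm := mul_meas_ge_le_integral_of_nonneg (μ := DP N) (f := fun y => (QQ β y h - 1) ^ 2)
    (Filter.Eventually.of_forall fun y => sq_nonneg _) (integrable_QQ β h) (t ^ 2)
  have hsub : {y : DS N | t ≤ |QQ β y h - 1|} ⊆ {y | t ^ 2 ≤ (QQ β y h - 1) ^ 2} := by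
    intro y hy
    have hy : t ≤ |QQ β y h - 1| := hy
    show t ^ 2 ≤ _
    rw [← sq_abs (QQ β y h - 1)]
    exact pow_le_pow_left₀ ht.le hy 2
  have h4 : (DP N).real {y | t ≤ |QQ β y h - 1|} ≤ N * h ^ 4 / (k1 β * kp β) * kC β / t ^ 2 := by
    rw [le_div_iff₀ (by positivity), mul_comm]
    refine le_trans (mul_le_mul_of_nonneg_left (measureReal_mono hsub) (by positivity))
      (hm.trans ((second_moment hN β h hβ0 hβ1 hs').trans ?_))
    gcongr
  rw [← ofReal_measureReal]
  exact ENNReal.ofReal_le_ofReal h4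

end disorder

/-! ### Transfer from GOE to the Gaussian disorder space -/

section transfer
variable {N : ℕ}

def goeS (N : ℕ) (p : Fin N × Fin N) : ℝ :=
  if p.1 = p.2 then Real.sqrt (2 / N) else Real.sqrt (1 / N)

def goeM (y : DS N) : Matrix (Fin N) (Fin N) ℝ :=
  Matrix.of fun i j => if i ≤ j then goeS N (i, j) * y (Sum.inl (i, j))
    else goeS N (j, i) * y (Sum.inl (j, i))

lemma goe_law (N : ℕ) : MeasurePreserving
    (fun (y : DS N) (p : Fin N × Fin N) => goeS N p * y (Sum.inl p)) (DP N)
    (Measure.pi fun p : Fin N × Fin N =>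
      if p.1 = p.2 then gaussianReal 0 (2 / N) else gaussianReal 0 (1 / N)) := by
  have h1 : MeasurePreserving (fun (y : DS N) (p : Fin N × Fin N) => y (Sum.inl p)) (DP N)
      (gamPi (Fin N × Fin N)) := by
    have a := measurePreserving_sumPiEquivProdPi (ι := Fin N × Fin N) (ι' := Fin N)
      (X := fun _ => ℝ) (fun _ => gam)
    have b := measurePreserving_fst (μ := Measure.pi fun _ : Fin N × Fin N => gam)
      (ν := Measure.pi fun _ : Fin N => gam)
    exact b.comp a
  have : ∀ p : Fin N × Fin N, SigmaFinite
      (if p.1 = p.2 then gaussianReal 0 (2 / N) else gaussianReal 0 (1 / N)) := by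
    intro p; split_ifs <;> infer_instance
  have h2 : MeasurePreserving (fun (x : Fin N × Fin N → ℝ) (p : Fin N × Fin N) => goeS N p * x p)
      (gamPi (Fin N × Fin N)) (Measure.pi fun p : Fin N × Fin N =>
      if p.1 = p.2 then gaussianReal 0 (2 / N) else gaussianReal 0 (1 / N)) := by
    refine measurePreserving_pi (f := fun p (t : ℝ) => goeS N p * t) _ _ fun p => ⟨by fun_prop, ?_⟩
    rw [gaussianReal_map_const_mul]
    simp only [mul_zero, mul_one, goeS]
    split_ifs with hp
    · congr 1
      apply NNReal.eq
      show Real.sqrt (2 / N) ^ 2 = _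
      rw [Real.sq_sqrt (by positivity)]
      simp
    · congr 1
      apply NNReal.eq
      show Real.sqrt (1 / N) ^ 2 = _
      rw [Real.sq_sqrt (by positivity)]
      simp
  exact h2.comp h1

lemma GOE_ge (N : ℕ) (S : Set (Matrix (Fin N) (Fin N) ℝ)) :
    DP N {y | goeM y ∈ S} ≤ GOE N S := by
  have hm : Measurable (fun W : Fin N × Fin N → ℝ =>
      (Matrix.of fun i j => if i ≤ j then W (i, j) else W (j, i) : Matrix (Fin N) (Fin N) ℝ)) := by
    refine measurable_pi_iff.2 fun i => measurable_pi_iff.2 fun j => ?_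
    show Measurable fun W : Fin N × Fin N → ℝ => if i ≤ j then W (i, j) else W (j, i)
    split_ifs <;> fun_prop
  unfold GOE
  rw [← (goe_law N).map_eq, Measure.map_map hm (goe_law N).measurable]
  exact Measure.le_map_apply (hm.comp (goe_law N).measurable).aemeasurable S

lemma skWeight_goeM (hN : 0 < N) (β h : ℝ) (y : DS N) (σ : Fin N → Bool) :
    skWeight (goeM y) β h σ = Real.exp (skV β y h σ) := by
  have hN' : (0 : ℝ) < N := by exact_mod_cast hN
  unfold skWeight skV
  congr 2
  set s : Fin N → ℝ := fun i => spin (σ i) with hs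
  have h2N : Real.sqrt (2 * N) = Real.sqrt 2 * Real.sqrt N := Real.sqrt_mul (by norm_num) _
  have r2 : Real.sqrt 2 ^ 2 = 2 := Real.sq_sqrt (by norm_num)
  have p2 : 0 < Real.sqrt 2 := by positivity
  have pN : 0 < Real.sqrt N := by positivity
  -- split the double sum
  have e1 : ∑ i, ∑ j, goeM y i j * s i * s j =
      ∑ i, ∑ j, (if i ≤ j then goeS N (i, j) * y (Sum.inl (i, j)) * (s i * s j) else 0) +
      ∑ i, ∑ j, (if i < j then goeS N (i, j) * y (Sum.inl (i, j)) * (s i * s j) else 0) := by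
    have sw : ∑ i, ∑ j, (if i < j then goeS N (i, j) * y (Sum.inl (i, j)) * (s i * s j) else 0) =
        ∑ i, ∑ j, (if j < i then goeS N (j, i) * y (Sum.inl (j, i)) * (s i * s j) else 0) := by
      rw [Finset.sum_comm]
      refine Finset.sum_congr rfl fun i _ => Finset.sum_congr rfl fun j _ => ?_
      split_ifs <;> ring
    rw [sw, ← Finset.sum_add_distrib]
    refine Finset.sum_congr rfl fun i _ => ?_
    rw [← Finset.sum_add_distrib]
    refine Finset.sum_congr rfl fun j _ => ?_
    simp only [goeM, Matrix.of_apply]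
    rcases le_or_gt i j with hij | hij
    · simp only [hij, if_true, hij.not_gt, if_false]; ring
    · simp only [hij, if_true, hij.not_ge, if_false]; ring
  have e2 : ∑ i, ∑ j, goeM y i j * spin (σ i) * spin (σ j) = ∑ i, ∑ j, goeM y i j * s i * s j := rfl
  rw [e2, e1, ← Finset.sum_add_distrib, skU, Fintype.sum_prod_type, Finset.mul_sum]
  refine Finset.sum_congr rfl fun i _ => ?_
  rw [← Finset.sum_add_distrib, Finset.mul_sum]
  refine Finset.sum_congr rfl fun j _ => ?_
  show _ = y (Sum.inl (i, j)) * (β / Real.sqrt (2 * N) * wc i j * (s i * s j))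
  unfold goeS wc
  rw [Real.sqrt_div (by norm_num), Real.sqrt_div (by norm_num), Real.sqrt_one, h2N]
  rcases lt_trichotomy i j with hij | hij | hij
  · simp only [hij, hij.le, hij.ne, if_true, if_false]
    field_simp
    try ring
  · subst hij
    simp only [le_refl, lt_irrefl, if_true, if_false]
    field_simp
    linear_combination (β * y (Sum.inl (i, i)) * s i ^ 2) * r2
  · simp [hij.not_gt, hij.not_ge, hij.ne']

lemma meanMag_goeM (hN : 0 < N) (β h : ℝ) (y : DS N) :
    meanMag (goeM y) β h = mm β y h := by
  have hZ : 0 < skZ (goeM y) β h := by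
    unfold skZ
    simp only [skWeight_goeM hN]
    exact sumexp_pos _
  have hd : ∀ σ, 0 ≤ skDensity (goeM y) β h σ := fun σ => by
    unfold skDensity
    refine div_nonneg ?_ hZ.le
    unfold skWeight; exact (Real.exp_pos _).le
  unfold meanMag skGibbs
  rw [integral_finsetSum_measure (fun σ _ => ?_)]
  · simp only [integral_smul_measure, integral_dirac, ENNReal.toReal_ofReal (hd _), smul_eq_mul]
    unfold mm gav
    rw [one_div, inv_mul_eq_div]
    congr 1
    rw [Finset.sum_div]
    refine Finset.sum_congr rfl fun σ _ => ?_
    unfold skDensity skZ magS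
    simp only [skWeight_goeM hN]
    ring
  · exact Integrable.of_finite.smul_measure ENNReal.ofReal_ne_top

end transfer

/-! ### Deterministic consequences of the good event -/

section det
variable {N : ℕ}

lemma det_D (hN : 0 < N) (β K t : ℝ) (hβ0 : 0 < β) (hβ1 : β < 1) (y : DS N)
    (hg : ∀ j ∈ Finset.range (⌊K * N⌋₊ + 2), |mm β y ((j : ℝ) / N) - q1 β ((j : ℝ) / N)| < t)
    (h : ℝ) (h0 : 0 ≤ h) (hK : h ≤ K) : |mm β y h - q1 β h| ≤ t + q1L β * (1 / N) := by
  have hN' : (0 : ℝ) < N := by exact_mod_cast hN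
  have hL : 0 ≤ q1L β := by
    have : 0 < 1 - β ^ 2 := by nlinarith
    unfold q1L; positivity
  set j := ⌊h * N⌋₊ with hj
  have hjK : j ≤ ⌊K * N⌋₊ := Nat.floor_le_floor (by gcongr)
  have hj1 : (j : ℝ) ≤ h * N := Nat.floor_le (by positivity)
  have hj2 : h * N < j + 1 := Nat.lt_floor_add_one _
  have a1 : (j : ℝ) / N ≤ h := (div_le_iff₀ hN').2 hj1
  have a2 : h ≤ ((j + 1 : ℕ) : ℝ) / N := by
    rw [le_div_iff₀ hN']; push_cast; exact hj2.le
  have a3 : ((j + 1 : ℕ) : ℝ) / N = (j : ℝ) / N + 1 / N := by push_cast; ring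
  have g1 := abs_lt.1 (hg j (Finset.mem_range.2 (by omega)))
  have g2 := abs_lt.1 (hg (j + 1) (Finset.mem_range.2 (by omega)))
  have m1 := mm_mono hN β _ _ y a1
  have m2 := mm_mono hN β _ _ y a2
  have l1 := q1_lip β h ((j : ℝ) / N) hβ0 hβ1
  have l2 := q1_lip β h (((j + 1 : ℕ) : ℝ) / N) hβ0 hβ1
  have d1 : |h - (j : ℝ) / N| ≤ 1 / N := by rw [abs_le]; constructor <;> linarith [one_div_pos.2 hN']
  have d2 : |h - ((j + 1 : ℕ) : ℝ) / N| ≤ 1 / N := by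
    rw [abs_le]; constructor <;> linarith [one_div_pos.2 hN']
  have l1' := abs_le.1 (l1.trans (mul_le_mul_of_nonneg_left d1 hL))
  have l2' := abs_le.1 (l2.trans (mul_le_mul_of_nonneg_left d2 hL))
  rw [abs_le]
  constructor <;> linarith [g1.1, g1.2, g2.1, g2.2, l1'.1, l1'.2, l2'.1, l2'.2]

lemma logcosh_lower (x η : ℝ) :
    η * Real.tanh x ≤ Real.log (Real.cosh (x + η)) - Real.log (Real.cosh x) := by
  have key : ∀ x, lse (fun b : Bool => x * spin b) = Real.log 2 + Real.log (Real.cosh x) := by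
    intro x
    rw [← Real.log_mul (by norm_num) (Real.cosh_pos x).ne', lse]
    congr 1
    rw [Fintype.sum_bool, Real.cosh_eq]
    simp [spin]
    ring
  have := gav_le_lse (fun b : Bool => x * spin b) (fun b => η * spin b)
  have e : (fun b : Bool => x * spin b + η * spin b) = fun b => (x + η) * spin b := by
    funext b; ring
  rw [e, key, key, gav_const_mul] at this
  have e2 : gav (fun b : Bool => x * spin b) spin = Real.tanh x := by
    rw [gav, Fintype.sum_bool, Fintype.sum_bool, Real.tanh_eq_sinh_div_cosh, Real.sinh_eq, Real.cosh_eq]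
    simp [spin]
    field_simp
    ring
  have e3 : gav (fun b : Bool => x * spin b) (fun b => spin b) = Real.tanh x := e2
  rw [e3] at this
  linarith

lemma logcosh_upper (x η : ℝ) :
    Real.log (Real.cosh (x + η)) - Real.log (Real.cosh x) ≤ η * Real.tanh (x + η) := by
  have := logcosh_lower (x + η) (-η)
  rw [add_neg_cancel_right] at this
  linarith

lemma LZ_near (β h y0 : ℝ) (hy0 : y0 ≤ 1 / 2) (y : DS N) (hq : |QQ β y h - 1| < y0) :
    |LZ β y h - LZ β y 0 - N * Real.log (Real.cosh h)| ≤ 2 * y0 := by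
  have hq' := abs_lt.1 hq
  have hQ : 1 / 2 < QQ β y h := by linarith [hq'.1]
  have hQ0 : 0 < QQ β y h := by linarith
  have e := congrArg Real.log (QQ_eq β y h)
  rw [Real.log_exp, Real.log_mul hQ0.ne' (pow_pos (Real.cosh_pos h) N).ne', Real.log_pow] at e
  have e2 : LZ β y h - LZ β y 0 - N * Real.log (Real.cosh h) = Real.log (QQ β y h) := by linarith
  rw [e2, abs_le]
  have u1 := Real.log_le_sub_one_of_pos hQ0
  have u2 := Real.one_sub_inv_le_log_of_pos hQ0
  constructor
  · have : (QQ β y h)⁻¹ ≤ 1 + 2 * y0 := by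
      rw [inv_le_iff_one_le_mul₀ hQ0]
      nlinarith [hq'.1]
    linarith
  · linarith [hq'.2]

lemma det_E (hN : 0 < N) (β η y0 : ℝ) (J : ℕ) (hη : 0 < η) (hy0 : y0 ≤ 1 / 2) (y : DS N)
    (hg : ∀ k ∈ Finset.range (J + 4), |QQ β y (((k : ℝ) - 1) * η) - 1| < y0)
    (h : ℝ) (h0 : 0 ≤ h) (hJ : ⌊h / η⌋₊ ≤ J) :
    |mm β y h - Real.tanh h| ≤ 2 * η + 4 * (y0 / (η * N)) := by
  have hN' : (0 : ℝ) < N := by exact_mod_cast hN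
  set j := ⌊h / η⌋₊ with hj
  have hj1 : (j : ℝ) ≤ h / η := Nat.floor_le (by positivity)
  have hj2 : h / η < j + 1 := Nat.lt_floor_add_one _
  have a1 : (j : ℝ) * η ≤ h := by rwa [le_div_iff₀ hη] at hj1
  have a2 : h < (j + 1) * η := by rwa [div_lt_iff₀ hη] at hj2
  have g : ∀ k : ℕ, k < J + 4 → _ := fun k hk =>
    abs_le.1 (LZ_near β (((k : ℝ) - 1) * η) y0 hy0 y (hg k (Finset.mem_range.2 hk)))
  have g0 := g j (by omega)
  have g1 := g (j + 1) (by omega)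
  have g2 := g (j + 2) (by omega)
  have g3 := g (j + 3) (by omega)
  set x0 : ℝ := ((j : ℝ) - 1) * η with hx0
  have x1 : (((j + 1 : ℕ) : ℝ) - 1) * η = x0 + η := by rw [hx0]; push_cast; ring
  have x2 : (((j + 2 : ℕ) : ℝ) - 1) * η = x0 + η + η := by rw [hx0]; push_cast; ring
  have x3 : (((j + 3 : ℕ) : ℝ) - 1) * η = x0 + η + η + η := by rw [hx0]; push_cast; ring
  rw [x1] at g1
  rw [x2] at g2
  rw [x3] at g3
  have b1 : x0 + η ≤ h := by rw [hx0]; linarith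
  have b2 : h ≤ x0 + η + η := by rw [hx0]; linarith
  have hηN : 0 < η * N := by positivity
  have hdiv : y0 / (η * N) * (η * N) = y0 := div_mul_cancel₀ _ hηN.ne'
  rw [abs_le]
  constructor
  · -- lower bound
    have m1 := mm_mono hN β _ _ y b1
    have m2 := LZ_upper hN β x0 η y
    have m3 := logcosh_lower x0 η
    have m4 := tanh_lip h x0
    have m5 : |h - x0| ≤ 2 * η := by rw [abs_le]; constructor <;> linarith
    have m6 := (abs_le.1 (m4.trans m5)).2
    have m7 := mul_le_mul_of_nonneg_left m3 hN'.le
    have m8 : (η * N) * (Real.tanh h - 2 * η - 4 * (y0 / (η * N))) ≤ (η * N) * mm β y (x0 + η) := by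
      have : (η * N) * (Real.tanh h - 2 * η - 4 * (y0 / (η * N))) =
        (η * N) * (Real.tanh h - 2 * η) - 4 * y0 := by rw [← hdiv]; field_simp
      rw [this]
      have m9 : (η * N) * (Real.tanh h - 2 * η) ≤ (η * N) * Real.tanh x0 :=
        mul_le_mul_of_nonneg_left (by linarith) hηN.le
      linarith [g0.1, g0.2, g1.1, g1.2]
    have := le_of_mul_le_mul_left m8 hηN
    linarith
  · have m1 := mm_mono hN β _ _ y b2
    have m2 := LZ_lower hN β (x0 + η + η) η y
    have m3 := logcosh_upper (x0 + η + η) η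
    have m4 := tanh_lip (x0 + η + η + η) h
    have m5 : |x0 + η + η + η - h| ≤ 2 * η := by rw [abs_le]; constructor <;> linarith
    have m6 := (abs_le.1 (m4.trans m5)).2
    have m7 := mul_le_mul_of_nonneg_left m3 hN'.le
    have m8 : (η * N) * mm β y (x0 + η + η) ≤ (η * N) * (Real.tanh h + 2 * η + 4 * (y0 / (η * N))) := by
      have : (η * N) * (Real.tanh h + 2 * η + 4 * (y0 / (η * N))) =
        (η * N) * (Real.tanh h + 2 * η) + 4 * y0 := by rw [← hdiv]; field_simp
      rw [this]
      have m9 : (η * N) * Real.tanh (x0 + η + η + η) ≤ (η * N) * (Real.tanh h + 2 * η) :=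
        mul_le_mul_of_nonneg_left (by linarith) hηN.le
      linarith [g2.1, g2.2, g3.1, g3.2]
    have := le_of_mul_le_mul_left m8 hηN
    linarith

end det

/-! ### Final assembly -/

section final
open Filter Topology

lemma kC_nonneg (β : ℝ) : 0 ≤ kC β := by
  unfold kC
  exact add_nonneg (integral_nonneg fun _ => (Real.exp_pos _).le)
    (integral_nonneg fun _ => (Real.exp_pos _).le)

/-- the good event has large probability -/
lemma good_prob {N : ℕ} (hN : 0 < N) (β K t η y0 δ H : ℝ) (J : ℕ) (hβ0 : 0 < β) (hβ1 : β < 1)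
    (hK : 0 < K) (ht : 0 ≤ t) (hη : 0 < η) (hy0 : 0 < y0) (hδ : 0 < δ)
    (hH : (J + 2 : ℝ) * η ≤ H)
    (hs : N * H ^ 4 / k1 β ≤ kp β)
    (hA : (K * N + 2) * (kC β * Real.exp (-(kp β * klam β / 2 * N * t ^ 2))) ≤ δ / 2)
    (hB : (J + 4 : ℝ) * (N * H ^ 4 / (k1 β * kp β) * kC β / y0 ^ 2) ≤ δ / 2) :
    ENNReal.ofReal (1 - δ) ≤ DP N {y |
      (∀ j ∈ Finset.range (⌊K * N⌋₊ + 2), |mm β y ((j : ℝ) / N) - q1 β ((j : ℝ) / N)| < t) ∧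
      (∀ k ∈ Finset.range (J + 4), |QQ β y (((k : ℝ) - 1) * η) - 1| < y0)} := by
  obtain ⟨hl, hk1, hp, hp1⟩ := consts_pos β hβ0 hβ1
  have hkC := kC_nonneg β
  have hN' : (0 : ℝ) < N := by exact_mod_cast hN
  set G := {y : DS N |
      (∀ j ∈ Finset.range (⌊K * N⌋₊ + 2), |mm β y ((j : ℝ) / N) - q1 β ((j : ℝ) / N)| < t) ∧
      (∀ k ∈ Finset.range (J + 4), |QQ β y (((k : ℝ) - 1) * η) - 1| < y0)} with hG
  set A := ⋃ j ∈ Finset.range (⌊K * N⌋₊ + 2),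
    {y : DS N | t ≤ |mm β y ((j : ℝ) / N) - q1 β ((j : ℝ) / N)|} with hAd
  set B := ⋃ k ∈ Finset.range (J + 4),
    {y : DS N | y0 ≤ |QQ β y (((k : ℝ) - 1) * η) - 1|} with hBd
  have hcov : (Set.univ : Set (DS N)) ⊆ G ∪ (A ∪ B) := by
    intro y _
    by_cases h1 : y ∈ A
    · exact Or.inr (Or.inl h1)
    by_cases h2 : y ∈ B
    · exact Or.inr (Or.inr h2)
    left
    simp only [hAd, hBd, Set.mem_iUnion, not_exists, Set.mem_ofPred_eq, not_le] at h1 h2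
    exact ⟨h1, h2⟩
  have hAm : DP N A ≤ ENNReal.ofReal (δ / 2) := by
    refine (measure_biUnion_finset_le _ _).trans ?_
    refine (Finset.sum_le_sum fun (j : ℕ) _ => mm_tail hN β ((j : ℝ) / N) t hβ0 hβ1 ht).trans ?_
    rw [Finset.sum_const, Finset.card_range, nsmul_eq_mul, ← ENNReal.ofReal_natCast,
      ← ENNReal.ofReal_mul (by positivity)]
    refine ENNReal.ofReal_le_ofReal (le_trans ?_ hA)
    have : (⌊K * N⌋₊ : ℝ) ≤ K * N := Nat.floor_le (by positivity)
    push_cast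
    gcongr
  have hBm : DP N B ≤ ENNReal.ofReal (δ / 2) := by
    refine (measure_biUnion_finset_le _ _).trans ?_
    have hk : ∀ k ∈ Finset.range (J + 4), (((k : ℝ) - 1) * η) ^ 4 ≤ H ^ 4 := by
      intro k hk
      have hk' : (k : ℝ) ≤ J + 3 := by
        have : k ≤ J + 3 := by have := Finset.mem_range.1 hk; omega
        exact_mod_cast this
      have hk0 : (0 : ℝ) ≤ k := Nat.cast_nonneg k
      have hJ0 : (0 : ℝ) ≤ J := Nat.cast_nonneg J
      have : |((k : ℝ) - 1) * η| ≤ H := by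
        rw [abs_mul, abs_of_pos hη]
        refine le_trans ?_ hH
        gcongr
        rw [abs_le]; constructor <;> linarith
      calc (((k : ℝ) - 1) * η) ^ 4 = |((k : ℝ) - 1) * η| ^ 4 := by
            rw [show (4 : ℕ) = 2 * 2 from rfl, pow_mul, pow_mul, sq_abs]
        _ ≤ H ^ 4 := by gcongr
    have hterm : ∀ k ∈ Finset.range (J + 4),
        DP N {y : DS N | y0 ≤ |QQ β y (((k : ℝ) - 1) * η) - 1|} ≤
          ENNReal.ofReal (N * H ^ 4 / (k1 β * kp β) * kC β / y0 ^ 2) := by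
      intro k hkm
      have h4 := hk k hkm
      refine (QQ_tail hN β _ y0 hβ0 hβ1 hy0 (le_trans ?_ hs)).trans
        (ENNReal.ofReal_le_ofReal ?_)
      · gcongr
      · gcongr
    refine (Finset.sum_le_sum hterm).trans ?_
    rw [Finset.sum_const, Finset.card_range, nsmul_eq_mul, ← ENNReal.ofReal_natCast,
      ← ENNReal.ofReal_mul (by positivity)]
    refine ENNReal.ofReal_le_ofReal (le_trans ?_ hB)
    push_cast
    exact le_rfl
  have htot : (1 : ENNReal) ≤ DP N G + ENNReal.ofReal δ := by
    calc (1 : ENNReal) = DP N Set.univ := measure_univ.symm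
      _ ≤ DP N (G ∪ (A ∪ B)) := measure_mono hcov
      _ ≤ DP N G + (DP N A + DP N B) :=
        (measure_union_le _ _).trans (add_le_add le_rfl (measure_union_le _ _))
      _ ≤ DP N G + (ENNReal.ofReal (δ / 2) + ENNReal.ofReal (δ / 2)) := by gcongr
      _ = DP N G + ENNReal.ofReal δ := by
        rw [← ENNReal.ofReal_add (by positivity) (by positivity), add_halves]
  rw [ENNReal.ofReal_sub _ hδ.le, ENNReal.ofReal_one, tsub_le_iff_right]
  exact htot

lemma tend_neg (e : ℝ) (he : e < 0) :
    Tendsto (fun N : ℕ => (N : ℝ) ^ e) atTop (𝓝 0) := by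
  have := (tendsto_rpow_neg_atTop (y := -e) (by linarith)).comp (tendsto_natCast_atTop_atTop (R := ℝ))
  simpa [Function.comp_def] using this

lemma tend_exp (ε c : ℝ) (hε : 0 < ε) (hc : 0 < c) :
    Tendsto (fun N : ℕ => (N : ℝ) * Real.exp (-c * (N : ℝ) ^ (2 * ε))) atTop (𝓝 0) := by
  have h1 := tendsto_rpow_mul_exp_neg_mul_atTop_nhds_zero (1 / (2 * ε)) c hc
  have h2 : Tendsto (fun N : ℕ => (N : ℝ) ^ (2 * ε)) atTop atTop :=
    (tendsto_rpow_atTop (by positivity)).comp tendsto_natCast_atTop_atTop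
  refine (h1.comp h2).congr fun N => ?_
  simp only [Function.comp]
  rw [← Real.rpow_mul (Nat.cast_nonneg N), mul_one_div_cancel (by positivity), Real.rpow_one]

end final

set_option maxHeartbeats 2000000
/-- High-temperature magnetization concentration for all fields: for
`β ∈ (0,1)`, small `ε > 0` and `K > 0`, with probability at least `1 − δ` over `W ~ GOE(N)`
(for `N` large), simultaneously for all `h ∈ [0,K]`: if `h < N^{−(1/4+ε)}` then
`|m_W(h) − q₁(β,h)| ≤ C (q₁(β,h) N^{−ε} + N^{−(1/2+ε)})`, and if `h ≥ N^{−(1/4+ε)}` then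
`|m_W(h) − q₁(β,h)| ≤ C N^{−(1/2−ε)}`. -/
theorem stmt5 (β ε K : ℝ) (hβ0 : 0 < β) (hβ1 : β < 1) (hε : 0 < ε) (hε' : ε < 1 / 100)
    (hK : 0 < K) :
    ∃ C : ℝ, 0 < C ∧ ∀ δ : ℝ, 0 < δ → ∃ N0 : ℕ, ∀ N : ℕ, N0 ≤ N →
      GOE N {W | ∀ h : ℝ, 0 ≤ h → h ≤ K →
          ((h < (N : ℝ) ^ (-(1 / 4 + ε)) →
            |meanMag W β h - q1 β h| ≤
              C * (q1 β h * (N : ℝ) ^ (-ε) + (N : ℝ) ^ (-(1 / 2 + ε)))) ∧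
           ((N : ℝ) ^ (-(1 / 4 + ε)) ≤ h →
            |meanMag W β h - q1 β h| ≤ C * (N : ℝ) ^ (-(1 / 2 - ε))))}
        ≥ ENNReal.ofReal (1 - δ) := by
  have hβ2 : 0 < 1 - β ^ 2 := by nlinarith
  obtain ⟨hl, hk1, hp, hp1⟩ := consts_pos β hβ0 hβ1
  have hkC := kC_nonneg β
  have hL : 0 ≤ q1L β := by unfold q1L; positivity
  set A : ℝ := 1 / (1 - β ^ 2) with hAdef
  have hA0 : 0 < A := by positivity
  refine ⟨2 * (1 + q1L β) + 6 + A, by positivity, fun δ hδ => ?_⟩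
  -- eventual conditions
  have e1 : ∀ᶠ N : ℕ in Filter.atTop, (N : ℝ) ^ (-(2 * ε)) < 1 / 2 :=
    (tend_neg (-(2 * ε)) (by linarith)).eventually_lt_const (by norm_num)
  have e2 : ∀ᶠ N : ℕ in Filter.atTop, 81 * (N : ℝ) ^ (-1 + 8 * ε) < k1 β * kp β := by
    have := (tend_neg (-1 + 8 * ε) (by linarith)).const_mul 81
    rw [mul_zero] at this
    exact this.eventually_lt_const (by positivity)
  have e3 : ∀ᶠ N : ℕ in Filter.atTop, (N : ℝ) ^ (-(1 / 4 + ε)) * (A + 1) < 1 / 2 := by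
    have := (tend_neg (-(1 / 4 + ε)) (by linarith)).mul_const (A + 1)
    rw [zero_mul] at this
    exact this.eventually_lt_const (by norm_num)
  have e4 : ∀ᶠ N : ℕ in Filter.atTop,
      (K + 2) * kC β * ((N : ℝ) * Real.exp (-(kp β * klam β / 2) * (N : ℝ) ^ (2 * ε))) < δ / 2 := by
    have := (tend_exp ε (kp β * klam β / 2) hε (by positivity)).const_mul ((K + 2) * kC β)
    rw [mul_zero] at this
    exact this.eventually_lt_const (by positivity)
  have e5 : ∀ᶠ N : ℕ in Filter.atTop,
      405 * kC β / (k1 β * kp β) * (N : ℝ) ^ (-1 + 15 * ε) < δ / 2 := by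
    have := (tend_neg (-1 + 15 * ε) (by linarith)).const_mul (405 * kC β / (k1 β * kp β))
    rw [mul_zero] at this
    exact this.eventually_lt_const (by positivity)
  obtain ⟨N0, hN0⟩ := Filter.eventually_atTop.1
    (e1.and (e2.and (e3.and (e4.and (e5.and (Filter.eventually_ge_atTop 1))))))
  refine ⟨N0, fun N hNN => ?_⟩
  obtain ⟨c1, c2, c3, c4, c5, c6⟩ := hN0 N hNN
  have hN : 0 < N := c6
  have hn : (0 : ℝ) < N := by exact_mod_cast hN
  have hn1 : (1 : ℝ) ≤ N := by exact_mod_cast c6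
  set n : ℝ := (N : ℝ) with hndef
  set t : ℝ := n ^ (-(1 / 2 - ε)) with htdef
  set η : ℝ := n ^ (-(1 / 2 + ε)) with hηdef
  set y0 : ℝ := n ^ (-(2 * ε)) with hy0def
  set a : ℝ := n ^ (3 * ε) with hadef
  set J : ℕ := ⌊a⌋₊ with hJdef
  have hn0 := hn.le
  have ht : 0 < t := Real.rpow_pos_of_pos hn _
  have hη : 0 < η := Real.rpow_pos_of_pos hn _
  have hy0 : 0 < y0 := Real.rpow_pos_of_pos hn _
  have ha1 : 1 ≤ a := Real.one_le_rpow hn1 (by positivity)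
  have hJa : (J : ℝ) ≤ a := Nat.floor_le (by positivity)
  have pw : ∀ (e : ℝ) (k : ℕ), (n ^ e) ^ k = n ^ (e * k) := fun e k => by
    rw [Real.rpow_mul hn0, Real.rpow_natCast]
  have hη4 : η ^ 4 = n ^ (-(2 + 4 * ε)) := by
    rw [hηdef, pw]; congr 1; push_cast; ring
  have ha4 : a ^ 4 = n ^ (12 * ε) := by rw [hadef, pw]; congr 1; push_cast; ring
  have r1 : n * (a ^ 4 * η ^ 4) = n ^ (-1 + 8 * ε) := by
    rw [ha4, hη4, ← Real.rpow_add hn]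
    nth_rewrite 1 [← Real.rpow_one n]
    rw [← Real.rpow_add hn]; congr 1; ring
  have r2 : a * n ^ (-1 + 8 * ε) = n ^ (-1 + 15 * ε) * y0 ^ 2 := by
    rw [hadef, hy0def, pw, ← Real.rpow_add hn, ← Real.rpow_add hn]; congr 1; push_cast; ring
  have r3 : n * t ^ 2 = n ^ (2 * ε) := by
    rw [htdef, pw]
    nth_rewrite 1 [← Real.rpow_one n]
    rw [← Real.rpow_add hn]; congr 1; push_cast; ring
  have r4 : y0 / (η * n) = η := by
    rw [div_eq_iff (by positivity), hy0def, hηdef]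
    nth_rewrite 4 [← Real.rpow_one n]
    rw [← Real.rpow_add hn, ← Real.rpow_add hn]; congr 1; ring
  have r5 : 1 / n ≤ t := by
    rw [one_div, ← Real.rpow_neg_one, htdef]
    exact Real.rpow_le_rpow_of_exponent_le hn1 (by linarith)
  have r6 : (a * η) ^ 2 ≤ η := by
    rw [hadef, hηdef, ← Real.rpow_add hn, pw]
    refine Real.rpow_le_rpow_of_exponent_le hn1 ?_
    push_cast; linarith
  have r7 : a * η * n ^ (-ε) = t := by
    rw [hadef, hηdef, htdef, ← Real.rpow_add hn, ← Real.rpow_add hn]; congr 1; ring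
  have hH : (J + 2 : ℝ) * η ≤ 3 * (a * η) := by nlinarith
  have hH4 : n * (3 * (a * η)) ^ 4 = 81 * n ^ (-1 + 8 * ε) := by
    rw [← r1]; ring
  refine le_trans (good_prob hN β K t η y0 δ (3 * (a * η)) J hβ0 hβ1 hK ht.le hη hy0 hδ hH
    ?_ ?_ ?_) (le_trans (measure_mono ?_) (GOE_ge N _))
  · rw [← hndef, hH4, div_le_iff₀ hk1]
    linarith
  · refine le_trans ?_ c4.le
    rw [← hndef, mul_assoc _ n (t ^ 2), r3, neg_mul]
    have : K * n + 2 ≤ (K + 2) * n := by nlinarith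
    calc (K * n + 2) * (kC β * Real.exp (-(kp β * klam β / 2 * n ^ (2 * ε))))
        ≤ ((K + 2) * n) * (kC β * Real.exp (-(kp β * klam β / 2 * n ^ (2 * ε)))) := by gcongr
      _ = _ := by ring
  · refine le_trans ?_ c5.le
    rw [← hndef, hH4]
    have h5 : (J + 4 : ℝ) ≤ 5 * a := by linarith
    calc (J + 4 : ℝ) * (81 * n ^ (-1 + 8 * ε) / (k1 β * kp β) * kC β / y0 ^ 2)
        ≤ (5 * a) * (81 * n ^ (-1 + 8 * ε) / (k1 β * kp β) * kC β / y0 ^ 2) := by gcongr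
      _ = 405 * kC β / (k1 β * kp β) * ((a * n ^ (-1 + 8 * ε)) / y0 ^ 2) := by ring
      _ = 405 * kC β / (k1 β * kp β) * n ^ (-1 + 15 * ε) := by
        rw [r2, mul_div_cancel_right₀ _ (by positivity)]
  · rintro y ⟨g1, g2⟩ h h0 hhK
    rw [meanMag_goeM hN]
    have hD := det_D hN β K t hβ0 hβ1 y g1 h h0 hhK
    have hD' : |mm β y h - q1 β h| ≤ (1 + q1L β) * t := by
      refine hD.trans ?_
      have := mul_le_mul_of_nonneg_left r5 hL
      rw [← hndef]; linarith
    refine ⟨fun hlt => ?_, fun _ => hD'.trans ?_⟩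
    · have hq : h / 2 ≤ q1 β h := q1_ge β h hβ0 hβ1 h0 (by
        rw [← hAdef]
        refine le_trans ?_ c3.le
        gcongr)
      have hne : 0 < n ^ (-ε) := Real.rpow_pos_of_pos hn _
      have hqn : 0 ≤ q1 β h * n ^ (-ε) := mul_nonneg (by linarith) hne.le
      by_cases hh : h ≤ a * η
      · have hE := det_E hN β η y0 J hη c1.le y g2 h h0
          (Nat.floor_le_floor (by rw [div_le_iff₀ hη]; exact hh))
        rw [← hndef, r4] at hE
        have hT := q1_tanh β h hβ0 hβ1
        rw [← hAdef] at hT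
        have hh2 : h ^ 2 ≤ η := (pow_le_pow_left₀ h0 hh 2).trans r6
        have hT2 : A * h ^ 2 ≤ A * η := by gcongr
        have hfin : |mm β y h - q1 β h| ≤ (6 + A) * η := by
          have e := abs_sub_le (mm β y h) (Real.tanh h) (q1 β h)
          rw [abs_sub_comm (Real.tanh h)] at e
          linarith
        have : 0 ≤ (1 + q1L β) * η := by positivity
        have : 0 ≤ (2 * (1 + q1L β) + 6 + A) * (q1 β h * n ^ (-ε)) := by positivity
        linarith
      · push Not at hh
        have h6 : t ≤ 2 * (q1 β h * n ^ (-ε)) := by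
          rw [← r7]
          have := mul_le_mul_of_nonneg_right (hh.le.trans (by linarith : h ≤ 2 * q1 β h)) hne.le
          linarith
        have h7 : (1 + q1L β) * t ≤ (1 + q1L β) * (2 * (q1 β h * n ^ (-ε))) := by gcongr
        have : 0 ≤ (6 + A) * (q1 β h * n ^ (-ε)) := by positivity
        have : 0 ≤ (2 * (1 + q1L β) + 6 + A) * η := by positivity
        linarith
    · exact mul_le_mul_of_nonneg_right (by linarith) ht.le
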